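/- Let I = (−ρ, ρ), (0, ρ) or [0, ρ), where 0 < ρ ≤ ∞, and let 𝐤 = (k₁, …, k_m) ∈ ℤ₊^m be admissible, so that k_p = 0 for p ∈ [1 : m₀] and k_p ≥ 1 for p ∈ [m₀+1 : m]; set k_max := max{1, k₁, …, k_m}. For a function f : I^m → ℝ, the following are equivalent: (1) for every n ≥ k_max and every m-tuple (B^{(1)}, …, B^{(m)}) with B^{(p)} an n×n real symmetric matrix with entries in I having at most k_p negative eigenvalues for each p, the matrix f[B^{(1)}, …, B^{(m)}] is positive semidefinite; (2) for every n ≥ k_max and every m-tuple (B^{(1)}, …, B^{(m)}) with B^{(p)} having exactly k_p negative eigenvalues and entries in I for each p, the matrix f[B^{(1)}, …, B^{(m)}] is positive semidefinite; (3) f is independent of the variables x_{m₀+1}, …, x_m and is represented on I^m by a convergent power series in the reduced tuple (x₁, …, x_{m₀}) with all Maclaurin coefficients non-negative. Moreover, if 𝐤 = 𝟎 and l ≥ 1, then f[−] sends every m-tuple of n×n positive semidefinite matrices with entries in I (for every n ≥ 1) to a matrix with at most l negative eigenvalues if and only if f is represented on I^m by a power series Σ_{α ∈ ℤ₊^m}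 c_α x^α with c_α ≥ 0 for all α ∈ ℤ₊^m \ {𝟎}. -/

import Mathlib

/-- The number of negative eigenvalues (with multiplicity) of a real symmetric
(Hermitian) matrix; junk value `0` if the matrix is not Hermitian. -/
noncomputable def negEigCount {n : Type*} [Fintype n] [DecidableEq n]
    (A : Matrix n n ℝ) : ℕ :=
  if hA : A.IsHermitian then Nat.card {i // hA.eigenvalues i < 0} else 0

section

open Matrix Filter Topology

theorem exists_diagonalization {ι : Type*} [Fintype ι] [DecidableEq ι] {A : Matrix ι ι ℝ}
    (hA : A.IsHermitian) : ∃ P : Matrix ι ι ℝ, Pᵀ * P = 1 ∧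
      ∀ v, v ⬝ᵥ (A *ᵥ v) = ∑ i, hA.eigenvalues i * ((Pᵀ *ᵥ v) i) ^ 2 := by
  refine ⟨hA.eigenvectorUnitary, ?_, fun v => ?_⟩
  · have := Unitary.coe_star_mul_self hA.eigenvectorUnitary
    rwa [star_eq_conjTranspose, conjTranspose_eq_transpose_of_trivial] at this
  · conv_lhs => rw [hA.spectral_theorem]
    rw [Unitary.conjStarAlgAut_apply, ← mulVec_mulVec, ← mulVec_mulVec,
      star_eq_conjTranspose, conjTranspose_eq_transpose_of_trivial,
      dotProduct_mulVec, ← mulVec_transpose]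
    simp only [dotProduct, mulVec_diagonal]
    refine Finset.sum_congr rfl fun i _ => ?_
    simp
    ring

theorem exists_ne_zero_forall_dotProduct_eq_zero {κ κ' : Type*} [Fintype κ] [Fintype κ']
    (T : Matrix κ' κ ℝ) (h : Fintype.card κ' < Fintype.card κ) :
    ∃ a : κ → ℝ, a ≠ 0 ∧ T *ᵥ a = 0 := by
  have : LinearMap.ker T.mulVecLin ≠ ⊥ := by
    apply LinearMap.ker_ne_bot_of_finrank_lt
    simpa using h
  obtain ⟨a, ha, h0⟩ := (Submodule.ne_bot_iff _).mp this
  exact ⟨a, h0, by simpa using ha⟩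

theorem negEigCount_le_of_nonneg {ι : Type*} [Fintype ι] [DecidableEq ι] {A : Matrix ι ι ℝ}
    {k : ℕ} (W : Matrix (Fin k) ι ℝ) (h : ∀ v, W *ᵥ v = 0 → 0 ≤ v ⬝ᵥ (A *ᵥ v)) :
    negEigCount A ≤ k := by
  classical
  unfold negEigCount
  split_ifs with hA
  swap
  · exact Nat.zero_le _
  by_contra! hlt
  rw [Nat.card_eq_fintype_card] at hlt
  obtain ⟨P, hP, hQ⟩ := exists_diagonalization hA
  let E : Matrix ι {i // hA.eigenvalues i < 0} ℝ := Matrix.of fun i j => if i = j.1 then 1 else 0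
  obtain ⟨a, ha, h0⟩ := exists_ne_zero_forall_dotProduct_eq_zero (W * P * E) (by simpa using hlt)
  have h1 := h (P *ᵥ (E *ᵥ a)) (by rw [← h0, mulVec_mulVec, mulVec_mulVec, Matrix.mul_assoc])
  rw [hQ, mulVec_mulVec, hP, one_mulVec] at h1
  have hE : ∀ i, (E *ᵥ a) i = if hi : hA.eigenvalues i < 0 then a ⟨i, hi⟩ else 0 := by
    intro i
    simp only [E, mulVec, dotProduct, of_apply, ite_mul, one_mul, zero_mul]
    split_ifs with hi
    · rw [Finset.sum_eq_single ⟨i, hi⟩] <;> aesop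
    · exact Finset.sum_eq_zero fun j _ => if_neg fun hij : i = j.1 => hi (by rw [hij]; exact j.2)
  have hle : ∀ i ∈ Finset.univ, hA.eigenvalues i * (E *ᵥ a) i ^ 2 ≤ 0 := by
    intro i _
    rw [hE]
    split_ifs with hi
    · exact mul_nonpos_of_nonpos_of_nonneg hi.le (sq_nonneg _)
    · simp
  have h2 := (Finset.sum_eq_zero_iff_of_nonpos hle).mp (le_antisymm (Finset.sum_nonpos hle) h1)
  apply ha
  funext j
  have := h2 j.1 (Finset.mem_univ _)
  rw [hE, dif_pos j.2] at this
  rcases mul_eq_zero.mp this with h3 | h3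
  · exact absurd h3 j.2.ne
  · exact pow_eq_zero_iff two_ne_zero |>.mp h3

theorem exists_nonneg_of_negEigCount_lt {ι : Type*} [Fintype ι] [DecidableEq ι]
    {A : Matrix ι ι ℝ} (hA : A.IsHermitian) {κ : Type*} [Fintype κ]
    (hk : negEigCount A < Fintype.card κ) (V : Matrix ι κ ℝ) :
    ∃ a : κ → ℝ, a ≠ 0 ∧ 0 ≤ (V *ᵥ a) ⬝ᵥ (A *ᵥ (V *ᵥ a)) := by
  classical
  unfold negEigCount at hk
  rw [dif_pos hA, Nat.card_eq_fintype_card] at hk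
  obtain ⟨P, hP, hQ⟩ := exists_diagonalization hA
  let E : Matrix {i // hA.eigenvalues i < 0} ι ℝ := Matrix.of fun j i => if i = j.1 then 1 else 0
  obtain ⟨a, ha, h0⟩ := exists_ne_zero_forall_dotProduct_eq_zero (E * Pᵀ * V) hk
  refine ⟨a, ha, ?_⟩
  rw [hQ]
  refine Finset.sum_nonneg fun i _ => ?_
  by_cases hi : hA.eigenvalues i < 0
  · have := congrFun h0 ⟨i, hi⟩
    rw [← mulVec_mulVec, ← mulVec_mulVec] at this
    have h3 : (Pᵀ *ᵥ (V *ᵥ a)) i = 0 := by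
      simpa [E, mulVec, dotProduct] using this
    rw [h3]; simp
  · exact mul_nonneg (not_lt.mp hi) (sq_nonneg _)

theorem exists_negEigCount_witness {ι : Type*} [Fintype ι] [DecidableEq ι] {A : Matrix ι ι ℝ}
    (hA : A.IsHermitian) :
    ∃ W : Matrix (Fin (negEigCount A)) ι ℝ, ∀ v, W *ᵥ v = 0 → 0 ≤ v ⬝ᵥ (A *ᵥ v) := by
  classical
  obtain ⟨P, hP, hQ⟩ := exists_diagonalization hA
  have hk : Fintype.card {i // hA.eigenvalues i < 0} = negEigCount A := by
    unfold negEigCount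
    rw [dif_pos hA, Nat.card_eq_fintype_card]
  let e := Fintype.equivFinOfCardEq hk
  refine ⟨Matrix.of fun j i => P i (e.symm j).1, fun v hv => ?_⟩
  rw [hQ]
  refine Finset.sum_nonneg fun i _ => ?_
  by_cases hi : hA.eigenvalues i < 0
  · have h3 : (Pᵀ *ᵥ v) i = 0 := by
      have := congrFun hv (e ⟨i, hi⟩)
      simpa [mulVec, dotProduct] using this
    rw [h3]; simp
  · exact mul_nonneg (not_lt.mp hi) (sq_nonneg _)

theorem negEigCount_submatrix_le {ι ι' : Type*} [Fintype ι] [DecidableEq ι] [Fintype ι']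
    [DecidableEq ι'] {A : Matrix ι ι ℝ} (hA : A.IsHermitian) (e : ι' ≃ ι) :
    negEigCount (A.submatrix e e) ≤ negEigCount A := by
  obtain ⟨W, hW⟩ := exists_negEigCount_witness hA
  refine negEigCount_le_of_nonneg (W.submatrix id e) fun v hv => ?_
  have hv' : W *ᵥ (v ∘ e.symm) = 0 := by
    rw [← hv]
    simpa using (submatrix_mulVec_equiv W v id e).symm
  have := hW _ hv'
  rw [submatrix_mulVec_equiv]
  rwa [← comp_equiv_symm_dotProduct]

theorem negEigCount_submatrix_equiv {ι ι' : Type*} [Fintype ι] [DecidableEq ι] [Fintype ι']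
    [DecidableEq ι'] {A : Matrix ι ι ℝ} (hA : A.IsHermitian) (e : ι' ≃ ι) :
    negEigCount (A.submatrix e e) = negEigCount A := by
  refine le_antisymm (negEigCount_submatrix_le hA e) ?_
  have := negEigCount_submatrix_le (hA.submatrix e) e.symm
  simpa using this

theorem negEigCount_eq_zero_iff {ι : Type*} [Fintype ι] [DecidableEq ι] {A : Matrix ι ι ℝ}
    (hA : A.IsHermitian) : negEigCount A = 0 ↔ A.PosSemidef := by
  unfold negEigCount
  rw [dif_pos hA, hA.posSemidef_iff_eigenvalues_nonneg, Nat.card_eq_fintype_card,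
    Fintype.card_eq_zero_iff, isEmpty_subtype]
  simp [Pi.le_def]

theorem negEigCount_sub_indicator {ι α : Type*} [Fintype ι] [DecidableEq ι] [Fintype α]
    {P : Matrix α α ℝ} (hP : P.PosSemidef) (π : ι → α) {k : ℕ} (τ : ι → Option (Fin k))
    (d : Fin k → ℝ) (hd : ∀ i, 0 < d i) (y : ι) (hy : τ y = none) (x : Fin k → ι)
    (hx : ∀ i, τ (x i) = some i) (hπ : ∀ i, π (x i) = π y) :
    (Matrix.of fun s t : ι => P (π s) (π t) -
      ∑ i, d i * (if τ s = some i ∧ τ t = some i then 1 else 0)).IsHermitian ∧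
    negEigCount (Matrix.of fun s t : ι => P (π s) (π t) -
      ∑ i, d i * (if τ s = some i ∧ τ t = some i then 1 else 0)) = k := by
  set C := (Matrix.of fun s t : ι => P (π s) (π t) -
      ∑ i, d i * (if τ s = some i ∧ τ t = some i then 1 else 0)) with hC
  let Z : Matrix (Fin k) ι ℝ := Matrix.of fun i s => if τ s = some i then 1 else 0
  have hCeq : C = P.submatrix π π - Zᵀ * diagonal d * Z := by
    ext s t
    simp only [hC, of_apply, Matrix.sub_apply, submatrix_apply]
    rw [Matrix.mul_apply]
    simp only [mul_diagonal, transpose_apply, Z, of_apply]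
    congr 1
    refine Finset.sum_congr rfl fun i _ => ?_
    by_cases h1 : τ s = some i <;> by_cases h2 : τ t = some i <;> simp [h1, h2]
  have hQ : ∀ v, v ⬝ᵥ (C *ᵥ v) =
      v ⬝ᵥ (P.submatrix π π *ᵥ v) - ∑ i, d i * ((Z *ᵥ v) i) ^ 2 := by
    intro v
    rw [hCeq, sub_mulVec, dotProduct_sub, ← mulVec_mulVec, ← mulVec_mulVec]
    congr 1
    rw [dotProduct_mulVec, ← mulVec_transpose, transpose_transpose]
    simp only [dotProduct, mulVec_diagonal]
    exact Finset.sum_congr rfl fun i _ => by ring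
  have hH : C.IsHermitian := by
    rw [hCeq]
    refine (hP.submatrix π).isHermitian.sub ?_
    rw [IsHermitian, conjTranspose_eq_transpose_of_trivial]
    simp [Matrix.mul_assoc]
  have hPs := (posSemidef_iff_dotProduct_mulVec.mp (hP.submatrix π)).2
  refine ⟨hH, le_antisymm (negEigCount_le_of_nonneg Z fun v hv => ?_) ?_⟩
  · rw [hQ, hv]
    simpa using hPs v
  · by_contra! hlt
    let V : Matrix ι (Fin k) ℝ :=
      Matrix.of fun s i => (if s = x i then 1 else 0) - (if s = y then 1 else 0)
    obtain ⟨a, ha, h0⟩ := exists_nonneg_of_negEigCount_lt hH (κ := Fin k) (by simpa using hlt) V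
    have hZV : Z * V = 1 := by
      ext i j
      simp only [mul_apply, V, Z, of_apply, mul_sub, Finset.sum_sub_distrib]
      simp [hy, hx, one_apply, eq_comm]
    have hPV : P.submatrix π π * V = 0 := by
      ext s j
      simp only [mul_apply, V, of_apply, mul_sub, Finset.sum_sub_distrib]
      simp [hπ]
    rw [hQ, mulVec_mulVec, mulVec_mulVec, hZV, hPV, one_mulVec] at h0
    simp only [zero_mulVec, dotProduct_zero, zero_sub] at h0
    apply ha
    have hnn : ∀ i ∈ Finset.univ, 0 ≤ d i * a i ^ 2 := fun i _ =>
      mul_nonneg (hd i).le (sq_nonneg _)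
    have hz := (Finset.sum_eq_zero_iff_of_nonneg hnn).mp
      (le_antisymm (by linarith) (Finset.sum_nonneg hnn))
    funext i
    rcases mul_eq_zero.mp (hz i (Finset.mem_univ _)) with h3 | h3
    · exact absurd h3 (hd i).ne'
    · exact pow_eq_zero_iff two_ne_zero |>.mp h3

/-- The mixed forward difference of `f` at `x` with increments `h i`, `i ∈ U`. -/
noncomputable def mixedDiff {κ V : Type*} [AddCommGroup V] (f : V → ℝ) (x : V) (h : κ → V)
    (U : Finset κ) : ℝ :=
  ∑ T ∈ U.powerset, (-1) ^ (U.card + T.card) * f (x + ∑ i ∈ T, h i)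

section mixedDiff

variable {κ V : Type*} [AddCommGroup V]

theorem mixedDiff_empty (f : V → ℝ) (x : V) (h : κ → V) : mixedDiff f x h ∅ = f x := by
  simp [mixedDiff]

theorem mixedDiff_insert [DecidableEq κ] (f : V → ℝ) (x : V) (h : κ → V) {U : Finset κ} {i : κ}
    (hi : i ∉ U) :
    mixedDiff f x h (insert i U) = mixedDiff f (x + h i) h U - mixedDiff f x h U := by
  unfold mixedDiff
  rw [Finset.sum_powerset_insert hi, Finset.card_insert_of_notMem hi, ← Finset.sum_add_distrib,
    ← Finset.sum_sub_distrib]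
  refine Finset.sum_congr rfl fun T hT => ?_
  have : i ∉ T := fun h => hi (Finset.mem_powerset.mp hT h)
  rw [Finset.card_insert_of_notMem this, Finset.sum_insert this, add_assoc x]
  ring

theorem mixedDiff_singleton (f : V → ℝ) (x : V) (h : κ → V) (i : κ) :
    mixedDiff f x h {i} = f (x + h i) - f x := by
  classical
  have := mixedDiff_insert f x h (Finset.notMem_empty i)
  simpa [mixedDiff_empty] using this

theorem sum_mixedDiff_powerset (f : V → ℝ) (x : V) (h : κ → V) (S : Finset κ) :
    ∑ U ∈ S.powerset, mixedDiff f x h U = f (x + ∑ i ∈ S, h i) := by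
  classical
  induction S using Finset.induction_on generalizing x with
  | empty => simp [mixedDiff_empty]
  | insert i S hi ih =>
    rw [Finset.sum_powerset_insert hi, Finset.sum_insert hi, ← add_assoc, ← ih (x + h i),
      ← Finset.sum_add_distrib]
    refine Finset.sum_congr rfl fun U hU => ?_
    rw [mixedDiff_insert _ _ _ fun h => hi (Finset.mem_powerset.mp hU h)]
    ring

theorem mixedDiff_congr {f g : V → ℝ} {x y : V} {h : κ → V} {U : Finset κ}
    (hfg : ∀ T ⊆ U, f (x + ∑ i ∈ T, h i) = g (y + ∑ i ∈ T, h i)) :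
    mixedDiff f x h U = mixedDiff g y h U :=
  Finset.sum_congr rfl fun T hT => by rw [hfg T (Finset.mem_powerset.mp hT)]

theorem sum_powerset_neg_one_pow (U : Finset κ) (hU : U.Nonempty) :
    ∑ T ∈ U.powerset, (-1 : ℝ) ^ T.card = 0 := by
  classical
  have := Finset.sum_powerset_neg_one_pow_card_of_nonempty hU
  exact_mod_cast this

theorem mixedDiff_same (f : V → ℝ) (x w : V) (U : Finset κ) :
    mixedDiff f x (fun _ => w) U = (fwdDiff w)^[U.card] f x := by
  classical
  induction U using Finset.induction_on generalizing x with
  | empty => simp [mixedDiff_empty]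
  | insert i S hi ih =>
    rw [mixedDiff_insert _ _ _ hi, ih, ih, Finset.card_insert_of_notMem hi,
      Function.iterate_succ_apply', fwdDiff]

theorem sum_sum_neg_one_pow_inter [DecidableEq κ] (F : Finset κ → ℝ) (U : Finset κ) :
    ∑ S ∈ U.powerset, ∑ T ∈ U.powerset, (-1) ^ S.card * (-1) ^ T.card * F (S ∩ T) =
      ∑ T ∈ U.powerset, (-1) ^ (U.card + T.card) * F T := by
  induction U using Finset.induction_on generalizing F with
  | empty => simp
  | insert i U hi ih =>
    have hmem : ∀ {S : Finset κ}, S ∈ U.powerset → i ∉ S := fun hS h =>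
      hi (Finset.mem_powerset.mp hS h)
    have key : ∑ S ∈ (insert i U).powerset, ∑ T ∈ (insert i U).powerset,
        (-1) ^ S.card * (-1) ^ T.card * F (S ∩ T) =
        ∑ S ∈ U.powerset, ∑ T ∈ U.powerset,
          (-1) ^ S.card * (-1) ^ T.card * (F (insert i (S ∩ T)) - F (S ∩ T)) := by
      simp only [Finset.sum_powerset_insert hi]
      rw [← Finset.sum_add_distrib]
      refine Finset.sum_congr rfl fun S hS => ?_
      rw [← Finset.sum_add_distrib, ← Finset.sum_add_distrib, ← Finset.sum_add_distrib]
      refine Finset.sum_congr rfl fun T hT => ?_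
      rw [Finset.card_insert_of_notMem (hmem hS), Finset.card_insert_of_notMem (hmem hT),
        Finset.insert_inter_of_notMem (hmem hT), Finset.inter_insert_of_notMem (hmem hS),
        ← Finset.insert_inter_distrib]
      ring
    rw [key, ih fun V => F (insert i V) - F V, Finset.sum_powerset_insert hi,
      ← Finset.sum_add_distrib, Finset.card_insert_of_notMem hi]
    refine Finset.sum_congr rfl fun T hT => ?_
    rw [Finset.card_insert_of_notMem (hmem hT)]
    ring

end mixedDiff

theorem summable_prod_pow {m : ℕ} {r : Fin m → ℝ} (h0 : ∀ p, 0 ≤ r p) (h1 : ∀ p, r p < 1) :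
    Summable fun α : Fin m → ℕ => ∏ p, r p ^ α p := by
  refine summable_of_sum_le (c := ∏ p, (1 - r p)⁻¹)
    (fun α => Finset.prod_nonneg fun p _ => pow_nonneg (h0 p) _) fun s => ?_
  obtain ⟨N, hN⟩ : ∃ N, ∀ α ∈ s, ∀ p, α p < N := by
    refine ⟨(s.sup fun α => Finset.univ.sup α) + 1, fun α hα p => Nat.lt_succ_of_le ?_⟩
    exact (Finset.le_sup (f := α) (Finset.mem_univ p)).trans
      (Finset.le_sup (f := fun α : Fin m → ℕ => Finset.univ.sup α) hα)
  calc ∑ α ∈ s, ∏ p, r p ^ α p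
      ≤ ∑ α ∈ Fintype.piFinset fun _ : Fin m => Finset.range N, ∏ p, r p ^ α p := by
        refine Finset.sum_le_sum_of_subset_of_nonneg (fun α hα => ?_)
          fun α _ _ => Finset.prod_nonneg fun p _ => pow_nonneg (h0 p) _
        simpa using hN α hα
    _ = ∏ p, ∑ k ∈ Finset.range N, r p ^ k := by
        rw [Finset.prod_univ_sum]
    _ ≤ ∏ p, (1 - r p)⁻¹ := by
        refine Finset.prod_le_prod (fun p _ => Finset.sum_nonneg fun k _ => pow_nonneg (h0 p) _)
          fun p _ => ?_
        rw [← tsum_geometric_of_lt_one (h0 p) (h1 p)]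
        exact (summable_geometric_of_lt_one (h0 p) (h1 p)).sum_le_tsum _
          fun k _ => pow_nonneg (h0 p) _

/-- Pointwise limits of power series with nonnegative coefficients are of the same form. -/
theorem exists_hasSum_of_tendsto {m : ℕ} {J : Set ℝ} (hJ : J.Nonempty) (hJ0 : ∀ x ∈ J, 0 ≤ x)
    (hJlt : ∀ x ∈ J, ∃ y ∈ J, x < y) {ι : Type*} {F : Filter ι} [F.NeBot]
    {c : ι → (Fin m → ℕ) → ℝ} (hc : ∀ i α, 0 ≤ c i α) {g : ι → (Fin m → ℝ) → ℝ}
    {f : (Fin m → ℝ) → ℝ}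
    (hg : ∀ x : Fin m → ℝ, (∀ p, x p ∈ J) →
      ∀ᶠ i in F, HasSum (fun α => c i α * ∏ p, x p ^ α p) (g i x))
    (hlim : ∀ x : Fin m → ℝ, (∀ p, x p ∈ J) → Tendsto (fun i => g i x) F (𝓝 (f x))) :
    ∃ d : (Fin m → ℕ) → ℝ, (∀ α, 0 ≤ d α) ∧
      ∀ x : Fin m → ℝ, (∀ p, x p ∈ J) → HasSum (fun α => d α * ∏ p, x p ^ α p) (f x) := by
  have hbound : ∀ y : Fin m → ℝ, (∀ p, y p ∈ J) → (∀ p, 0 < y p) →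
      ∀ᶠ i in F, ∀ α, c i α ≤ (f y + 1) / ∏ p, y p ^ α p := by
    intro y hy hy0
    filter_upwards [hg y hy, (hlim y hy).eventually_le_const (lt_add_one _)] with i h1 h2 α
    rw [le_div_iff₀ (Finset.prod_pos fun p _ => pow_pos (hy0 p) _)]
    refine (le_hasSum h1 α fun β _ => ?_).trans h2
    exact mul_nonneg (hc i β) (Finset.prod_nonneg fun p _ => pow_nonneg (hy0 p).le _)
  let u := Ultrafilter.of F
  have hu : (u : Filter ι) ≤ F := Ultrafilter.of_le F
  have hlimc : ∀ α, ∃ d, 0 ≤ d ∧ Tendsto (fun i => c i α) u (𝓝 d) := by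
    intro α
    obtain ⟨x0, hx0⟩ := hJ
    obtain ⟨y0, hy0, hlt⟩ := hJlt x0 hx0
    have hy0' : 0 < y0 := (hJ0 _ hx0).trans_lt hlt
    have hb := hbound (fun _ => y0) (fun _ => hy0) fun _ => hy0'
    obtain ⟨d, hd, hd'⟩ := (isCompact_Icc (a := (0 : ℝ))
      (b := (f (fun _ => y0) + 1) / ∏ p, y0 ^ α p)).ultrafilter_le_nhds
        (u.map fun i => c i α) (by
          rw [le_principal_iff, Ultrafilter.coe_map, mem_map]
          exact hu (hb.mono fun i hi => ⟨hc i α, hi α⟩))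
    exact ⟨d, hd.1, hd'⟩
  choose d hd0 hd using hlimc
  refine ⟨d, hd0, fun x hx => ?_⟩
  choose y hyJ hxy using fun p => hJlt (x p) (hx p)
  have hy0 : ∀ p, 0 < y p := fun p => (hJ0 _ (hx p)).trans_lt (hxy p)
  have hS : Summable fun α : Fin m → ℕ => (f y + 1) * ∏ p, (x p / y p) ^ α p :=
    (summable_prod_pow (fun p => div_nonneg (hJ0 _ (hx p)) (hy0 p).le)
      fun p => (div_lt_one (hy0 p)).mpr (hxy p)).mul_left _
  have hxα : ∀ α : Fin m → ℕ, 0 ≤ ∏ p, x p ^ α p := fun α =>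
    Finset.prod_nonneg fun p _ => pow_nonneg (hJ0 _ (hx p)) _
  have hbd : ∀ᶠ i in (u : Filter ι), ∀ α,
      ‖c i α * ∏ p, x p ^ α p‖ ≤ (f y + 1) * ∏ p, (x p / y p) ^ α p := by
    filter_upwards [hu (hbound y hyJ hy0)] with i hi α
    rw [Real.norm_of_nonneg (mul_nonneg (hc i α) (hxα α))]
    refine (mul_le_mul_of_nonneg_right (hi α) (hxα α)).trans (le_of_eq ?_)
    simp only [div_pow, Finset.prod_div_distrib]
    ring
  have hterm : ∀ α, Tendsto (fun i => c i α * ∏ p, x p ^ α p) u (𝓝 (d α * ∏ p, x p ^ α p)) :=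
    fun α => (hd α).mul_const _
  have hT := tendsto_tsum_of_dominated_convergence hS hterm hbd
  have hT' : Tendsto (fun i => ∑' α, c i α * ∏ p, x p ^ α p) u (𝓝 (f x)) := by
    refine ((hlim x hx).mono_left hu).congr' ?_
    filter_upwards [hu (hg x hx)] with i hi using hi.tsum_eq.symm
  have hsum : Summable fun α => d α * ∏ p, x p ^ α p := by
    refine Summable.of_norm_bounded hS fun α => ?_
    exact le_of_tendsto (hterm α).norm (hbd.mono fun i hi => hi α)
  rw [tendsto_nhds_unique hT' hT]
  exact hsum.hasSum

section randomSubset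

variable {Ω : Type*} [Fintype Ω] [DecidableEq Ω]

/-- The probability of the subset `S` when each `s` is selected independently with
probability `t s`. -/
noncomputable def subsetWeight (t : Ω → ℝ) (S : Finset Ω) : ℝ :=
  (∏ s ∈ S, t s) * ∏ s ∈ Sᶜ, (1 - t s)

theorem sum_subsetWeight (t : Ω → ℝ) : ∑ S, subsetWeight t S = 1 := by
  unfold subsetWeight
  rw [← Fintype.prod_add]
  simp

theorem sum_subsetWeight_superset (t : Ω → ℝ) (U : Finset Ω) :
    ∑ S, subsetWeight t S * (if U ⊆ S then 1 else 0) = ∏ s ∈ U, t s := by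
  have h := Fintype.prod_add t fun s => if s ∈ U then 0 else 1 - t s
  have h1 : ∏ s, (t s + if s ∈ U then 0 else 1 - t s) = ∏ s ∈ U, t s := by
    rw [← Finset.prod_subset (Finset.subset_univ U)]
    · exact Finset.prod_congr rfl fun s hs => by simp [hs]
    · intro s _ hs
      simp [hs]
  rw [← h1, h]
  refine Finset.sum_congr rfl fun S _ => ?_
  unfold subsetWeight
  rw [mul_assoc]
  congr 1
  split_ifs with hU
  · rw [mul_one]
    refine Finset.prod_congr rfl fun s hs => ?_
    rw [if_neg fun hsU => Finset.mem_compl.mp hs (hU hsU)]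
  · obtain ⟨s, hsU, hsS⟩ := Finset.not_subset.mp hU
    rw [mul_zero]
    refine (Finset.prod_eq_zero (i := s) (Finset.mem_compl.mpr hsS) ?_).symm
    simp [hsU]

theorem sum_subsetWeight_mem (t : Ω → ℝ) (s : Ω) :
    ∑ S, subsetWeight t S * (if s ∈ S then 1 else 0) = t s := by
  simpa using sum_subsetWeight_superset t {s}

theorem sum_subsetWeight_cov (t : Ω → ℝ) (s s' : Ω) :
    ∑ S, subsetWeight t S * (((if s ∈ S then 1 else 0) - t s) * ((if s' ∈ S then 1 else 0) - t s'))
      = if s = s' then t s * (1 - t s) else 0 := by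
  have h2 := sum_subsetWeight_superset t {s, s'}
  have hexp : ∀ S : Finset Ω, subsetWeight t S *
      (((if s ∈ S then 1 else 0) - t s) * ((if s' ∈ S then 1 else 0) - t s')) =
      subsetWeight t S * (if {s, s'} ⊆ S then 1 else 0)
      - t s' * (subsetWeight t S * (if s ∈ S then 1 else 0))
      - t s * (subsetWeight t S * (if s' ∈ S then 1 else 0)) + t s * t s' * subsetWeight t S := by
    intro S
    by_cases h : s ∈ S <;> by_cases h' : s' ∈ S <;> simp [h, h', Finset.insert_subset_iff] <;> ring
  simp only [hexp, Finset.sum_add_distrib, Finset.sum_sub_distrib, ← Finset.mul_sum]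
  rw [h2, sum_subsetWeight_mem, sum_subsetWeight_mem, sum_subsetWeight]
  split_ifs with h
  · subst h; simp; ring
  · rw [Finset.prod_pair h]; ring

theorem sum_subsetWeight_variance (t : Ω → ℝ) (P : Finset Ω) :
    ∑ S, subsetWeight t S * (∑ s ∈ P, ((if s ∈ S then 1 else 0) - t s)) ^ 2 =
      ∑ s ∈ P, t s * (1 - t s) := by
  simp only [sq, Finset.sum_mul_sum]
  simp only [Finset.mul_sum]
  rw [Finset.sum_comm]
  refine Finset.sum_congr rfl fun s hs => ?_
  rw [Finset.sum_comm]
  simp only [sum_subsetWeight_cov]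
  simp [hs]

theorem subsetWeight_nonneg {t : Ω → ℝ} (h0 : ∀ s, 0 ≤ t s) (h1 : ∀ s, t s ≤ 1) (S : Finset Ω) :
    0 ≤ subsetWeight t S :=
  mul_nonneg (Finset.prod_nonneg fun s _ => h0 s)
    (Finset.prod_nonneg fun s _ => sub_nonneg.mpr (h1 s))

theorem sum_subsetWeight_mul {V : Type*} [AddCommGroup V] (t : Ω → ℝ) (f : V → ℝ) (x : V)
    (h : Ω → V) :
    ∑ S, subsetWeight t S * f (x + ∑ s ∈ S, h s) =
      ∑ U, mixedDiff f x h U * ∏ s ∈ U, t s := by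
  have h1 : ∀ S : Finset Ω, f (x + ∑ s ∈ S, h s) =
      ∑ U, mixedDiff f x h U * (if U ⊆ S then 1 else 0) := by
    intro S
    rw [← sum_mixedDiff_powerset f x h S]
    simp only [mul_ite, mul_one, mul_zero]
    rw [← Finset.sum_filter]
    refine Finset.sum_congr ?_ fun _ _ => rfl
    ext U
    simp
  simp only [h1, Finset.mul_sum]
  rw [Finset.sum_comm]
  refine Finset.sum_congr rfl fun U _ => ?_
  rw [← sum_subsetWeight_superset, Finset.mul_sum]
  exact Finset.sum_congr rfl fun S _ => by ring

end randomSubset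

/-- A function of `m` variables is absolutely monotone on `J` if its mixed differences of positive
order with nonnegative increments are nonnegative. -/
def AbsMono {m : ℕ} (J : Set ℝ) (f : (Fin m → ℝ) → ℝ) : Prop :=
  ∀ (κ : Type) [Fintype κ] (x : Fin m → ℝ) (h : κ → Fin m → ℝ) (U : Finset κ),
    (∀ p, 0 ≤ x p) → (∀ i p, 0 ≤ h i p) → (∀ p, x p ∈ J) → (∀ p, x p + ∑ i, h i p ∈ J) →
    U.Nonempty → 0 ≤ mixedDiff f x h U

namespace AbsMono

variable {m : ℕ} {J : Set ℝ} {f : (Fin m → ℝ) → ℝ}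

theorem mono (hf : AbsMono J f) {x y : Fin m → ℝ} (h0 : ∀ p, 0 ≤ x p) (hx : ∀ p, x p ∈ J)
    (hy : ∀ p, y p ∈ J) (hxy : ∀ p, x p ≤ y p) : f x ≤ f y := by
  have := hf Unit x (fun _ => y - x) {()} h0 (fun _ p => sub_nonneg.mpr (hxy p)) hx
    (fun p => by simpa using hy p) ⟨(), by simp⟩
  rw [mixedDiff_singleton, add_sub_cancel] at this
  linarith

theorem second (hf : AbsMono J f) {x u v : Fin m → ℝ} (h0 : ∀ p, 0 ≤ x p) (hu : ∀ p, 0 ≤ u p)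
    (hv : ∀ p, 0 ≤ v p) (hx : ∀ p, x p ∈ J) (hy : ∀ p, x p + u p + v p ∈ J) :
    f (x + v) - f x ≤ f (x + u + v) - f (x + u) := by
  have := hf Bool x (fun i => if i then u else v) {true, false} h0
    (fun i p => by cases i <;> simp [hu, hv]) hx
    (fun p => by simpa [add_assoc] using hy p) ⟨true, by simp⟩
  rw [mixedDiff_insert _ _ _ (by simp), mixedDiff_singleton, mixedDiff_singleton] at this
  simp only [if_true, Bool.false_eq_true, if_false] at this
  linarith

theorem mul_sub_le (hJ : J.OrdConnected) (hf : AbsMono J f) {x h : Fin m → ℝ}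
    (h0 : ∀ p, 0 ≤ x p) (hh : ∀ p, 0 ≤ h p) (hx : ∀ p, x p ∈ J) (n : ℕ)
    (hy : ∀ p, x p + n * h p ∈ J) :
    n * (f (x + h) - f x) ≤ f (x + (n : ℝ) • h) - f x := by
  induction n with
  | zero => simp
  | succ n ih =>
    have h1 : ∀ p, x p + n * h p ∈ J := fun p => hJ.out (hx p) (hy p)
      ⟨le_add_of_nonneg_right (mul_nonneg n.cast_nonneg (hh p)), by push_cast; nlinarith [hh p]⟩
    have h2 := hf.second (u := (n : ℝ) • h) (v := h) h0
      (fun p => mul_nonneg n.cast_nonneg (hh p)) hh hx (fun p => by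
        have := hy p
        push_cast at this
        simpa [add_mul, add_assoc] using this)
    have h3 : x + ((n + 1 : ℕ) : ℝ) • h = x + (n : ℝ) • h + h := by
      push_cast
      rw [add_smul, one_smul, add_assoc]
    rw [h3]
    push_cast
    linarith [ih h1]

/-- Quantitative continuity of absolutely monotone functions. -/
theorem abs_sub_le (hJ : J.OrdConnected) (hf : AbsMono J f) (h0J : 0 ∈ J) {a b : ℝ} (ha : 0 ≤ a)
    (hab : a < b) (hb : b ∈ J) {x : Fin m → ℝ} (hx0 : ∀ p, 0 ≤ x p) (hxa : ∀ p, x p ≤ a)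
    {n : ℕ} (hn : 0 < n) {y : Fin m → ℝ} (hy0 : ∀ p, 0 ≤ y p) (hyb : ∀ p, y p ≤ b) :
    |f y - f x| ≤ (f (fun _ => b) - f 0) / n +
      (f (fun _ => b) - f 0) / ((b - a) / n) ^ 2 * ∑ p, (y p - x p) ^ 2 := by
  have hmem : ∀ t, 0 ≤ t → t ≤ b → t ∈ J := fun t h1 h2 => hJ.out h0J hb ⟨h1, h2⟩
  have hb0 : 0 ≤ b := ha.trans hab.le
  have hmono : ∀ u v : Fin m → ℝ, (∀ p, 0 ≤ u p) → (∀ p, u p ≤ v p) → (∀ p, v p ≤ b) →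
      f u ≤ f v := fun u v h1 h2 h3 => hf.mono h1 (fun p => hmem _ (h1 p) ((h2 p).trans (h3 p)))
    (fun p => hmem _ ((h1 p).trans (h2 p)) (h3 p)) h2
  set M := f (fun _ => b) - f 0 with hM
  have hM0 : 0 ≤ M := sub_nonneg.mpr (hmono 0 _ (fun _ => le_rfl) (fun _ => hb0) fun _ => le_rfl)
  have hn' : (0 : ℝ) < n := Nat.cast_pos.mpr hn
  set δ := (b - a) / n with hδ
  have hδ0 : 0 < δ := div_pos (sub_pos.mpr hab) hn'
  have hxb : ∀ p, x p ≤ b := fun p => (hxa p).trans hab.le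
  by_cases hc : ∀ p, |y p - x p| ≤ δ
  · have h1 : |f y - f x| ≤ M / n := by
      let lo : Fin m → ℝ := fun p => min (x p) (y p)
      have hlo0 : ∀ p, 0 ≤ lo p := fun p => le_min (hx0 p) (hy0 p)
      have hloa : ∀ p, lo p ≤ a := fun p => (min_le_left _ _).trans (hxa p)
      have hnδ : n * δ = b - a := by rw [hδ]; field_simp
      have hδle : δ ≤ b - a := by
        rw [← hnδ]
        exact le_mul_of_one_le_left hδ0.le (by exact_mod_cast hn)
      have hx' : f x ≤ f (lo + fun _ => δ) := hmono _ _ hx0 (fun p => by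
          have := abs_le.mp (hc p)
          show x p ≤ min (x p) (y p) + δ
          rw [← min_add_add_right]
          exact le_min (by linarith) (by linarith)) fun p => by
            have := hloa p
            show lo p + δ ≤ b
            linarith
      have hy' : f y ≤ f (lo + fun _ => δ) := hmono _ _ hy0 (fun p => by
          have := abs_le.mp (hc p)
          show y p ≤ min (x p) (y p) + δ
          rw [← min_add_add_right]
          exact le_min (by linarith) (by linarith)) fun p => by
            have := hloa p
            show lo p + δ ≤ b
            linarith
      have hlx : f lo ≤ f x := hmono _ _ hlo0 (fun p => min_le_left _ _) hxb
      have hly : f lo ≤ f y := hmono _ _ hlo0 (fun p => min_le_right _ _) hyb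
      have hs := hf.mul_sub_le hJ (x := lo) (h := fun _ => δ) hlo0 (fun _ => hδ0.le)
        (fun p => hmem _ (hlo0 p) ((hloa p).trans hab.le)) n (fun p => hmem _
          (add_nonneg (hlo0 p) (by rw [hnδ]; linarith)) (by rw [hnδ]; linarith [hloa p]))
      have h4 : f (lo + (n : ℝ) • fun _ => δ) ≤ f fun _ => b := hmono _ _
        (fun p => add_nonneg (hlo0 p) (mul_nonneg hn'.le hδ0.le)) (fun p => by
          show lo p + n * δ ≤ b
          rw [hnδ]; linarith [hloa p]) fun _ => le_rfl
      have h5 : f 0 ≤ f lo := hmono _ _ (fun _ => le_rfl) hlo0 fun p => (hloa p).trans hab.le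
      have h6 : f (lo + fun _ => δ) - f lo ≤ M / n := by
        rw [le_div_iff₀ hn', mul_comm]
        linarith
      exact abs_le.mpr ⟨by linarith, by linarith⟩
    refine h1.trans (le_add_of_nonneg_right ?_)
    exact mul_nonneg (div_nonneg hM0 (sq_nonneg _)) (Finset.sum_nonneg fun p _ => sq_nonneg _)
  · push Not at hc
    obtain ⟨p, hp⟩ := hc
    have h1 : |f y - f x| ≤ M := by
      have := hmono 0 x (fun _ => le_rfl) hx0 hxb
      have := hmono 0 y (fun _ => le_rfl) hy0 hyb
      have := hmono x (fun _ => b) hx0 hxb fun _ => le_rfl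
      have := hmono y (fun _ => b) hy0 hyb fun _ => le_rfl
      exact abs_le.mpr ⟨by linarith, by linarith⟩
    have h2 : δ ^ 2 ≤ ∑ p, (y p - x p) ^ 2 := by
      refine le_trans ?_ (Finset.single_le_sum (f := fun p => (y p - x p) ^ 2)
        (fun p _ => sq_nonneg _) (Finset.mem_univ p))
      show δ ^ 2 ≤ (y p - x p) ^ 2
      rw [← sq_abs (y p - x p)]
      exact pow_le_pow_left₀ hδ0.le hp.le 2
    refine h1.trans (le_trans ?_ (le_add_of_nonneg_left (div_nonneg hM0 hn'.le)))
    rw [div_mul_eq_mul_div, le_div_iff₀ (pow_pos hδ0 2)]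
    exact mul_le_mul_of_nonneg_left h2 hM0

end AbsMono

/-- The increments of the random point of the Bernstein approximation on `[0, b]`. -/
noncomputable def bernsteinStep (m N : ℕ) (b : ℝ) (s : Fin m × Fin N) : Fin m → ℝ :=
  Pi.single s.1 (b / N)

theorem sum_bernsteinStep {m N : ℕ} {b : ℝ} (S : Finset (Fin m × Fin N)) (p : Fin m) :
    (∑ s ∈ S, bernsteinStep m N b s) p =
      b / N * ∑ s ∈ Finset.univ.filter fun s : Fin m × Fin N => s.1 = p,
        if s ∈ S then 1 else 0 := by
  rw [Finset.sum_apply, Finset.mul_sum, Finset.sum_filter]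
  have : ∀ s : Fin m × Fin N, bernsteinStep m N b s p = if s.1 = p then b / N else 0 := fun s => by
    simp [bernsteinStep, Pi.single_apply, eq_comm]
  simp only [this]
  rw [← Finset.sum_filter_add_sum_filter_not Finset.univ (· ∈ S)]
  have h2 : ∀ s ∈ Finset.univ.filter (fun s : Fin m × Fin N => s ∉ S),
    (if s.1 = p then b / N * (if s ∈ S then 1 else 0) else 0) = 0 := by
    intro s hs
    simp [(Finset.mem_filter.mp hs).2]
  rw [Finset.sum_eq_zero h2, add_zero]
  refine Finset.sum_congr (by ext; simp) fun s hs => ?_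
  simp [(Finset.mem_filter.mp hs).2]

theorem card_filter_fst_eq {m N : ℕ} (p : Fin m) :
    (Finset.univ.filter fun s : Fin m × Fin N => s.1 = p).card = N := by
  have : (Finset.univ.filter fun s : Fin m × Fin N => s.1 = p) = {p} ×ˢ Finset.univ := by
    ext s
    rw [Finset.mem_filter, Finset.mem_product]
    simp
  rw [this]
  simp

theorem sum_subsetWeight_bernsteinStep_le {m N : ℕ} {b : ℝ} (hb : 0 < b) (hN : 0 < N)
    {x : Fin m → ℝ} (p : Fin m) :
    ∑ S, subsetWeight (fun s : Fin m × Fin N => x s.1 / b) S *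
      ((∑ s ∈ S, bernsteinStep m N b s) p - x p) ^ 2 ≤ b ^ 2 / N := by
  have hN' : (0 : ℝ) < N := Nat.cast_pos.mpr hN
  have h1 : ∀ S : Finset (Fin m × Fin N), ((∑ s ∈ S, bernsteinStep m N b s) p - x p) =
      b / N * ∑ s ∈ Finset.univ.filter fun s : Fin m × Fin N => s.1 = p,
        ((if s ∈ S then 1 else 0) - x s.1 / b) := by
    intro S
    rw [sum_bernsteinStep, Finset.sum_sub_distrib, mul_sub]
    congr 1
    rw [Finset.sum_congr rfl (g := fun _ => x p / b) fun s hs => by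
      rw [(Finset.mem_filter.mp hs).2], Finset.sum_const, card_filter_fst_eq, nsmul_eq_mul]
    field_simp
  simp only [h1, mul_pow]
  have h2 : ∀ S : Finset (Fin m × Fin N), subsetWeight (fun s : Fin m × Fin N => x s.1 / b) S *
      ((b / N) ^ 2 * (∑ s ∈ Finset.univ.filter fun s : Fin m × Fin N => s.1 = p,
        ((if s ∈ S then 1 else 0) - x s.1 / b)) ^ 2) =
      (b / N) ^ 2 * (subsetWeight (fun s : Fin m × Fin N => x s.1 / b) S *
      (∑ s ∈ Finset.univ.filter fun s : Fin m × Fin N => s.1 = p,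
        ((if s ∈ S then 1 else 0) - x s.1 / b)) ^ 2) := fun S => by ring
  simp only [h2]
  rw [← Finset.mul_sum, sum_subsetWeight_variance]
  have h3 : ∑ s ∈ Finset.univ.filter (fun s : Fin m × Fin N => s.1 = p),
      x s.1 / b * (1 - x s.1 / b) ≤ N := by
    refine (Finset.sum_le_card_nsmul _ _ 1 fun s _ => ?_).trans (by
      rw [card_filter_fst_eq]; simp)
    nlinarith [sq_nonneg (x s.1 / b - 1 / 2)]
  calc (b / N) ^ 2 * _ ≤ (b / N) ^ 2 * N := mul_le_mul_of_nonneg_left h3 (sq_nonneg _)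
    _ = b ^ 2 / N := by field_simp

/-- The coefficients of the Bernstein polynomial of `f` on `[0, b]`, without constant term. -/
noncomputable def bernsteinCoeff {m : ℕ} (f : (Fin m → ℝ) → ℝ) (b : ℝ) (N : ℕ)
    (α : Fin m → ℕ) : ℝ :=
  ∑ U : Finset (Fin m × Fin N), if α = fun p => (U.filter fun s => s.1 = p).card then
    (if U.Nonempty then mixedDiff f 0 (bernsteinStep m N b) U / b ^ U.card else 0) else 0

theorem hasSum_bernsteinCoeff {m : ℕ} (f : (Fin m → ℝ) → ℝ) (b : ℝ) (N : ℕ) (x : Fin m → ℝ) :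
    HasSum (fun α => bernsteinCoeff f b N α * ∏ p, x p ^ α p)
      (∑ S, subsetWeight (fun s : Fin m × Fin N => x s.1 / b) S *
        f (0 + ∑ s ∈ S, bernsteinStep m N b s) - f 0) := by
  rw [sum_subsetWeight_mul]
  have h1 : ∑ U : Finset (Fin m × Fin N), mixedDiff f 0 (bernsteinStep m N b) U *
      ∏ s ∈ U, x s.1 / b - f 0 = ∑ U : Finset (Fin m × Fin N),
      (if U.Nonempty then mixedDiff f 0 (bernsteinStep m N b) U / b ^ U.card else 0) *
        ∏ p, x p ^ (U.filter fun s => s.1 = p).card := by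
    rw [← Finset.add_sum_erase _ _ (Finset.mem_univ (∅ : Finset (Fin m × Fin N))),
      ← Finset.add_sum_erase (f := fun U => (ite _ _ _) * _) _
        (Finset.mem_univ (∅ : Finset (Fin m × Fin N))), mixedDiff_empty]
    simp only [Finset.prod_empty, mul_one, add_sub_cancel_left, Finset.not_nonempty_empty, if_false,
      zero_mul, zero_add]
    refine Finset.sum_congr rfl fun U hU => ?_
    rw [if_pos (Finset.nonempty_iff_ne_empty.mpr (Finset.ne_of_mem_erase hU)),
      Finset.prod_div_distrib, Finset.prod_const, ← Finset.prod_fiberwise' U (fun s => s.1) x]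
    simp only [Finset.prod_const]
    ring
  rw [h1]
  have h2 : (fun α => bernsteinCoeff f b N α * ∏ p, x p ^ α p) = fun α => ∑ U, 
      if α = (fun p => (U.filter fun s => s.1 = p).card) then
      (if U.Nonempty then mixedDiff f 0 (bernsteinStep m N b) U / b ^ U.card else 0) *
        ∏ p, x p ^ (U.filter fun s : Fin m × Fin N => s.1 = p).card else 0 := by
    funext α
    unfold bernsteinCoeff
    rw [Finset.sum_mul]
    refine Finset.sum_congr rfl fun U _ => ?_
    by_cases h : α = fun p => (U.filter fun s => s.1 = p).card
    · rw [if_pos h, if_pos h, h]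
    · rw [if_neg h, if_neg h, zero_mul]
  rw [h2]
  exact hasSum_sum fun U _ => hasSum_ite_eq _ _

namespace AbsMono

variable {m : ℕ} {J : Set ℝ} {f : (Fin m → ℝ) → ℝ}

theorem bernsteinCoeff_nonneg (hf : AbsMono J f) (h0J : 0 ∈ J) {b : ℝ} (hb0 : 0 < b) (hb : b ∈ J)
    {N : ℕ} (hN : 0 < N) (α : Fin m → ℕ) : 0 ≤ bernsteinCoeff f b N α := by
  refine Finset.sum_nonneg fun U _ => ?_
  split_ifs with h1 h2
  · refine div_nonneg (hf _ _ _ _ (fun _ => le_rfl) (fun s p => ?_) (fun _ => h0J) (fun p => ?_) h2)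
      (pow_nonneg hb0.le _)
    · unfold bernsteinStep
      rw [Pi.single_apply]
      split_ifs
      · positivity
      · exact le_rfl
    · rw [← Finset.sum_apply, sum_bernsteinStep]
      simp only [Finset.mem_univ, if_true, Finset.sum_const, card_filter_fst_eq, nsmul_eq_mul,
        mul_one]
      have : (N : ℝ) ≠ 0 := by exact_mod_cast hN.ne'
      rw [div_mul_cancel₀ _ this]
      simpa using hb
  · exact le_rfl
  · exact le_rfl

theorem tendsto_bernstein (hJ : J.OrdConnected) (hf : AbsMono J f) (h0J : 0 ∈ J) {b : ℝ}
    (hb0 : 0 < b) (hb : b ∈ J) {x : Fin m → ℝ} (hx0 : ∀ p, 0 ≤ x p) (hxb : ∀ p, x p < b) :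
    Tendsto (fun N : ℕ => ∑ S, subsetWeight (fun s : Fin m × Fin (N + 1) => x s.1 / b) S *
        f (0 + ∑ s ∈ S, bernsteinStep m (N + 1) b s)) atTop (𝓝 (f x)) := by
  obtain ⟨a, ha0, hab, hxa⟩ : ∃ a, 0 ≤ a ∧ a < b ∧ ∀ p, x p ≤ a := by
    refine ⟨(insert 0 (Finset.univ.image x)).max' (Finset.insert_nonempty _ _), ?_, ?_, ?_⟩
    · exact Finset.le_max' _ _ (Finset.mem_insert_self _ _)
    · rw [Finset.max'_lt_iff]
      intro y hy
      rcases Finset.mem_insert.mp hy with rfl | hy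
      · exact hb0
      · obtain ⟨p, _, rfl⟩ := Finset.mem_image.mp hy
        exact hxb p
    · exact fun p => Finset.le_max' _ _ (Finset.mem_insert_of_mem
        (Finset.mem_image_of_mem _ (Finset.mem_univ p)))
  set M := f (fun _ => b) - f 0 with hM
  have hM0 : 0 ≤ M := sub_nonneg.mpr (hf.mono (fun _ => le_rfl) (fun _ => h0J) (fun _ => hb)
    fun _ => hb0.le)
  have key : ∀ n : ℕ, 0 < n → ∀ N : ℕ,
      |∑ S, subsetWeight (fun s : Fin m × Fin (N + 1) => x s.1 / b) S *
        f (0 + ∑ s ∈ S, bernsteinStep m (N + 1) b s) - f x| ≤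
      M / n + M / ((b - a) / n) ^ 2 * (m * (b ^ 2 / (N + 1 : ℕ))) := by
    intro n hn N
    set w := subsetWeight (fun s : Fin m × Fin (N + 1) => x s.1 / b) with hw
    have hw0 : ∀ S, 0 ≤ w S := subsetWeight_nonneg (fun s => div_nonneg (hx0 _) hb0.le)
      fun s => (div_le_one hb0).mpr (hxb _).le
    have hw1 : ∑ S, w S = 1 := sum_subsetWeight _
    have hN' : ((N + 1 : ℕ) : ℝ) ≠ 0 := by positivity
    calc _ = |∑ S, w S * (f (0 + ∑ s ∈ S, bernsteinStep m (N + 1) b s) - f x)| := by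
          simp only [mul_sub, Finset.sum_sub_distrib, ← Finset.sum_mul]
          rw [hw1, one_mul]
      _ ≤ ∑ S, w S * |f (0 + ∑ s ∈ S, bernsteinStep m (N + 1) b s) - f x| := by
          refine (Finset.abs_sum_le_sum_abs _ _).trans (Finset.sum_le_sum fun S _ => ?_)
          rw [abs_mul, abs_of_nonneg (hw0 S)]
      _ ≤ ∑ S, w S * (M / n + M / ((b - a) / n) ^ 2 *
            ∑ p, ((∑ s ∈ S, bernsteinStep m (N + 1) b s) p - x p) ^ 2) := by
          refine Finset.sum_le_sum fun S _ => mul_le_mul_of_nonneg_left ?_ (hw0 S)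
          rw [zero_add]
          have hcard : ∀ p, 0 ≤ ∑ s ∈ Finset.univ.filter fun s : Fin m × Fin (N + 1) => s.1 = p,
              (if s ∈ S then (1 : ℝ) else 0) := fun p => Finset.sum_nonneg fun s _ => by
            split_ifs <;> norm_num
          have hcard' : ∀ p, ∑ s ∈ Finset.univ.filter (fun s : Fin m × Fin (N + 1) => s.1 = p),
              (if s ∈ S then (1 : ℝ) else 0) ≤ (N + 1 : ℕ) := fun p => by
            refine (Finset.sum_le_card_nsmul _ _ 1 fun s _ => ?_).trans (by
              rw [card_filter_fst_eq]; simp)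
            split_ifs <;> norm_num
          refine hf.abs_sub_le hJ h0J ha0 hab hb hx0 hxa hn (fun p => ?_) fun p => ?_
          · rw [sum_bernsteinStep]
            exact mul_nonneg (by positivity) (hcard p)
          · rw [sum_bernsteinStep]
            refine (mul_le_mul_of_nonneg_left (hcard' p) (by positivity)).trans (le_of_eq ?_)
            exact div_mul_cancel₀ _ hN'
      _ = M / n + M / ((b - a) / n) ^ 2 *
            ∑ p, ∑ S, w S * ((∑ s ∈ S, bernsteinStep m (N + 1) b s) p - x p) ^ 2 := by
          simp only [mul_add, Finset.sum_add_distrib, ← Finset.sum_mul]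
          rw [hw1, one_mul, Finset.sum_comm, Finset.mul_sum]
          congr 1
          refine Finset.sum_congr rfl fun S _ => ?_
          rw [← Finset.mul_sum]
          ring
      _ ≤ M / n + M / ((b - a) / n) ^ 2 * (m * (b ^ 2 / (N + 1 : ℕ))) := by
          refine add_le_add_right (mul_le_mul_of_nonneg_left ?_
            (div_nonneg hM0 (sq_nonneg _))) _
          refine (Finset.sum_le_card_nsmul _ _ _ fun p _ =>
            sum_subsetWeight_bernsteinStep_le hb0 N.succ_pos p).trans ?_
          simp
  rw [Metric.tendsto_atTop]
  intro ε hε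
  obtain ⟨n, hn⟩ := exists_nat_gt (M / (ε / 2))
  have hn0 : (0 : ℝ) < n := (div_nonneg hM0 (half_pos hε).le).trans_lt hn
  have hlim : Tendsto (fun N : ℕ => M / n + M / ((b - a) / n) ^ 2 * (m * (b ^ 2 / (N + 1 : ℕ))))
      atTop (𝓝 (M / n + M / ((b - a) / n) ^ 2 * (m * 0))) :=
    tendsto_const_nhds.add (((tendsto_const_div_atTop_nhds_zero_nat (b ^ 2)).comp
      (tendsto_add_atTop_nat 1)).const_mul _ |>.const_mul _)
  have hlt : M / n + M / ((b - a) / n) ^ 2 * (m * 0) < ε := by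
    rw [mul_zero, mul_zero, add_zero, div_lt_iff₀ hn0]
    rw [div_lt_iff₀ (half_pos hε)] at hn
    nlinarith
  obtain ⟨N₀, hN₀⟩ := eventually_atTop.mp (hlim.eventually_lt_const hlt)
  exact ⟨N₀, fun N hN => (key n (by exact_mod_cast hn0) N).trans_lt (hN₀ N hN)⟩

/-- Bernstein's theorem in several variables, on an interval with left endpoint `0`. -/
theorem exists_hasSum_of_zero_mem (hJ : J.OrdConnected) (hf : AbsMono J f) (h0J : 0 ∈ J)
    (hJ0 : ∀ x ∈ J, 0 ≤ x) (hJlt : ∀ x ∈ J, ∃ y ∈ J, x < y) :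
    ∃ c : (Fin m → ℕ) → ℝ, (∀ α, 0 ≤ c α) ∧
      ∀ x : Fin m → ℝ, (∀ p, x p ∈ J) → HasSum (fun α => c α * ∏ p, x p ^ α p) (f x - f 0) := by
  have h1 : ∀ b : J, ∃ c : (Fin m → ℕ) → ℝ, (∀ α, 0 ≤ c α) ∧
      ∀ x : Fin m → ℝ, (∀ p, x p ∈ Set.Ico 0 (b : ℝ)) →
        HasSum (fun α => c α * ∏ p, x p ^ α p) (f x - f 0) := by
    rintro ⟨b, hb⟩
    rcases (hJ0 b hb).eq_or_lt with rfl | hb0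
    · refine ⟨0, fun _ => le_rfl, fun x hx => ?_⟩
      rcases isEmpty_or_nonempty (Fin m) with hm | ⟨⟨p⟩⟩
      · rw [Subsingleton.elim x 0, sub_self]
        simp
      · exact absurd (hx p) (by simp)
    · refine exists_hasSum_of_tendsto (J := Set.Ico 0 b) ⟨0, le_rfl, hb0⟩ (fun x hx => hx.1)
        (fun x hx => ?_) (F := atTop)
        (c := fun N : ℕ => bernsteinCoeff f b (N + 1))
        (fun N α => hf.bernsteinCoeff_nonneg h0J hb0 hb N.succ_pos α)
        (fun x hx => Eventually.of_forall fun N => hasSum_bernsteinCoeff f b (N + 1) x)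
        fun x hx => (hf.tendsto_bernstein hJ h0J hb0 hb (fun p => (hx p).1)
          fun p => (hx p).2).sub_const _
      obtain ⟨y, h1, h2⟩ := exists_between hx.2
      exact ⟨y, ⟨hx.1.trans h1.le, h2⟩, h1⟩
  choose c hc0 hc using h1
  have : Nonempty J := ⟨⟨0, h0J⟩⟩
  refine exists_hasSum_of_tendsto ⟨0, h0J⟩ hJ0 hJlt (F := atTop (α := J)) (c := c) hc0
    (g := fun _ x => f x - f 0) (fun x hx => ?_) fun x _ => tendsto_const_nhds
  have h2 : ∀ p, ∀ᶠ b : J in atTop, x p ∈ Set.Ico 0 (b : ℝ) := by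
    intro p
    obtain ⟨y, hy, hlt⟩ := hJlt _ (hx p)
    filter_upwards [eventually_ge_atTop (⟨y, hy⟩ : J)] with b hb
    exact ⟨hJ0 _ (hx p), hlt.trans_le hb⟩
  filter_upwards [eventually_all.mpr h2] with b hb using hc b x hb

end AbsMono

theorem eventually_add_mem {J : Set ℝ} (hJ : J.OrdConnected) {x : ℝ} (hx : x ∈ J)
    (hJlt : ∃ y ∈ J, x < y) : ∀ᶠ δ in 𝓝[>] (0 : ℝ), x + δ ∈ J := by
  obtain ⟨y, hy, hlt⟩ := hJlt
  filter_upwards [Ioo_mem_nhdsGT (sub_pos.mpr hlt)] with δ hδ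
  exact hJ.out hx hy ⟨by linarith [hδ.1], by linarith [hδ.2]⟩

namespace AbsMono

variable {m : ℕ} {J : Set ℝ} {f : (Fin m → ℝ) → ℝ}

theorem comp_add_const (hf : AbsMono J f) {ε : ℝ} (hε : 0 ≤ ε) :
    AbsMono {t | 0 ≤ t ∧ t + ε ∈ J} fun x => f (x + fun _ => ε) := by
  intro κ _ x h U hx0 hh hx hy hU
  have := hf κ (x + fun _ => ε) h U (fun p => add_nonneg (hx0 p) hε) hh (fun p => (hx p).2)
    (fun p => by simpa [add_right_comm] using (hy p).2) hU
  rwa [mixedDiff_congr (g := f) (y := x + fun _ => ε)]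
  intro T _
  show f (x + ∑ i ∈ T, h i + fun _ => ε) = _
  rw [add_right_comm]

/-- Bernstein's theorem in several variables. -/
theorem exists_hasSum (hJ : J.OrdConnected) (hf : AbsMono J f) (hJne : J.Nonempty)
    (hJ0 : ∀ x ∈ J, 0 ≤ x) (hJlt : ∀ x ∈ J, ∃ y ∈ J, x < y)
    (hJpos : ∀ y ∈ J, ∀ x, 0 < x → x ≤ y → x ∈ J) :
    ∃ (L : ℝ) (c : (Fin m → ℕ) → ℝ), (∀ α, 0 ≤ c α) ∧
      (∀ b, (∀ x : Fin m → ℝ, (∀ p, x p ∈ J) → b ≤ f x) → b ≤ L) ∧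
      ∀ x : Fin m → ℝ, (∀ p, x p ∈ J) → HasSum (fun α => c α * ∏ p, x p ^ α p) (f x - L) := by
  by_cases h0J : (0 : ℝ) ∈ J
  · obtain ⟨c, hc, hs⟩ := hf.exists_hasSum_of_zero_mem hJ h0J hJ0 hJlt
    exact ⟨f 0, c, hc, fun b hb => hb 0 fun _ => h0J, hs⟩
  have hpos : ∀ x ∈ J, 0 < x := fun x hx => (hJ0 x hx).lt_of_ne fun h => h0J (h ▸ hx)
  obtain ⟨x₀, hx₀⟩ := hJne
  have hx₀pos := hpos _ hx₀
  let ε : ℕ → ℝ := fun n => (x₀ / 2) / ((n : ℝ) + 1)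
  have hε0 : ∀ n, 0 < ε n := fun n => by positivity
  have hεle : ∀ n, ε n ≤ x₀ / 2 := fun n =>
    div_le_self (by positivity) (by linarith [n.cast_nonneg (α := ℝ)])
  have hεJ : ∀ n, ε n ∈ J := fun n => hJpos _ hx₀ _ (hε0 n) ((hεle n).trans (by linarith))
  have hεlim : Tendsto ε atTop (𝓝[>] 0) := by
    refine tendsto_nhdsWithin_iff.mpr ⟨?_, Eventually.of_forall hε0⟩
    have := (tendsto_const_div_atTop_nhds_zero_nat (x₀ / 2)).comp (tendsto_add_atTop_nat 1)
    refine this.congr fun n => ?_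
    simp [ε]
  have hεanti : Antitone ε := fun i j hij => by
    have : (i : ℝ) ≤ j := by exact_mod_cast hij
    exact div_le_div_of_nonneg_left (by positivity) (by positivity) (by linarith)
  have hhalf : x₀ / 2 ∈ J := hJpos _ hx₀ _ (by linarith) (by linarith)
  let φ : ℕ → ℝ := fun n => f fun _ => ε n
  have hφanti : Antitone φ := fun i j hij =>
    hf.mono (fun _ => (hε0 j).le) (fun _ => hεJ j) (fun _ => hεJ i) fun _ => hεanti hij
  have hφbdd : BddBelow (Set.range φ) := by
    refine ⟨2 * f (fun _ => x₀ / 2) - f fun _ => x₀, ?_⟩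
    rintro _ ⟨n, rfl⟩
    have h1 := hf.second (x := fun _ => ε n) (u := fun _ => x₀ / 2) (v := fun _ => x₀ / 2 - ε n)
      (fun _ => (hε0 n).le) (fun _ => by linarith) (fun _ => sub_nonneg.mpr (hεle n))
      (fun _ => hεJ n) (fun _ => by
        convert hx₀ using 1
        ring)
    have h2 : (fun _ : Fin m => ε n) + (fun _ => x₀ / 2 - ε n) = fun _ => x₀ / 2 := by
      funext p
      simp
    have h3 : (fun _ : Fin m => ε n) + (fun _ => x₀ / 2) + (fun _ => x₀ / 2 - ε n) =
        fun _ => x₀ := by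
      funext p
      simp only [Pi.add_apply]
      ring
    have h4 : f (fun _ => x₀ / 2) ≤ f ((fun _ : Fin m => ε n) + (fun _ => x₀ / 2)) :=
      hf.mono (fun _ => by linarith) (fun _ => hhalf) (fun _ => hJpos _ hx₀ _
        (by simp only [Pi.add_apply]; linarith [hε0 n])
        (by simp only [Pi.add_apply]; linarith [hεle n])) fun _ => by
          simp only [Pi.add_apply]; linarith [hε0 n]
    rw [h2, h3] at h1
    show _ ≤ f fun _ => ε n
    linarith
  have hφlim := tendsto_atTop_ciInf hφanti hφbdd
  set L := ⨅ n, φ n with hL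
  have hbern : ∀ n, ∃ c : (Fin m → ℕ) → ℝ, (∀ α, 0 ≤ c α) ∧
      ∀ x : Fin m → ℝ, (∀ p, 0 ≤ x p ∧ x p + ε n ∈ J) →
        HasSum (fun α => c α * ∏ p, x p ^ α p) (f (x + fun _ => ε n) - φ n) := by
    intro n
    obtain ⟨c, h1, h2⟩ := (hf.comp_add_const (hε0 n).le).exists_hasSum_of_zero_mem
      (J := {t | 0 ≤ t ∧ t + ε n ∈ J}) ⟨fun a ha b hb t ht => ⟨ha.1.trans ht.1, hJ.out ha.2 hb.2 ⟨by linarith [ht.1],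
        by linarith [ht.2]⟩⟩⟩ ⟨le_rfl, by simpa using hεJ n⟩ (fun x hx => hx.1) (fun x hx => by
          obtain ⟨y, hy, hlt⟩ := hJlt _ hx.2
          exact ⟨y - ε n, ⟨by linarith [hx.1], by simpa using hy⟩, by linarith⟩)
    refine ⟨c, h1, fun x hx => ?_⟩
    have := h2 x hx
    rwa [zero_add] at this
  choose c hc0 hc using hbern
  have hright : ∀ x : Fin m → ℝ, (∀ p, x p ∈ J) →
      Tendsto (fun n => f (x + fun _ => ε n)) atTop (𝓝 (f x)) := by
    intro x hx
    have hx0 : ∀ p, 0 ≤ x p := fun p => hJ0 _ (hx p)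
    obtain ⟨η, hη, hη0⟩ := ((eventually_all.mpr fun p =>
      eventually_add_mem hJ (hx p) (hJlt _ (hx p))).and self_mem_nhdsWithin).exists
    set M := f (x + fun _ => η) - f x with hM
    rw [Metric.tendsto_atTop]
    intro e he
    obtain ⟨N, hN⟩ := exists_nat_gt (max (M / e) 0)
    have hN0 : (0 : ℝ) < N := (le_max_right _ _).trans_lt hN
    have hMN : M / N < e := by
      rw [div_lt_iff₀ hN0]
      have := (le_max_left _ _).trans_lt hN
      rw [div_lt_iff₀ he] at this
      linarith
    have hev := hεlim.eventually (Ioo_mem_nhdsGT (div_pos hη0 hN0))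
    obtain ⟨n₀, hn₀⟩ := eventually_atTop.mp hev
    refine ⟨n₀, fun n hn => ?_⟩
    have hlt := hn₀ n hn
    have hηN : η / N ≤ η := div_le_self hη0.le (by
      have : 0 < N := by exact_mod_cast hN0
      exact_mod_cast this)
    have hmem : ∀ p, ∀ t, 0 ≤ t → t ≤ η → x p + t ∈ J := fun p t h1 h2 =>
      hJ.out (hx p) (hη p) ⟨by linarith, by linarith⟩
    have h1 : f x ≤ f (x + fun _ => ε n) := hf.mono hx0 hx
      (fun p => hmem p _ hlt.1.le (hlt.2.le.trans hηN)) fun p => le_add_of_nonneg_right hlt.1.le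
    have h2 : f (x + fun _ => ε n) ≤ f (x + fun _ => η / N) :=
      hf.mono (fun p => add_nonneg (hx0 p) hlt.1.le)
      (fun p => hmem p _ hlt.1.le (hlt.2.le.trans hηN)) (fun p => hmem p _ (by positivity) hηN)
      fun p => add_le_add_right hlt.2.le _
    have hNη : N * (η / N) = η := mul_div_cancel₀ _ hN0.ne'
    have h3 := hf.mul_sub_le hJ (x := x) (h := fun _ => η / N) hx0 (fun _ => by positivity) hx N
      (fun p => by rw [hNη]; exact hη p)
    have h4 : (N : ℝ) • (fun _ : Fin m => η / N) = fun _ => η := by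
      funext p
      simpa using hNη
    rw [h4, mul_comm, ← le_div_iff₀ hN0] at h3
    rw [Real.dist_eq, abs_of_nonneg (sub_nonneg.mpr h1)]
    linarith
  obtain ⟨d, hd0, hd⟩ := exists_hasSum_of_tendsto ⟨x₀, hx₀⟩ hJ0 hJlt (F := atTop) (c := c) hc0
    (g := fun n x => f (x + fun _ => ε n) - φ n) (f := fun x => f x - L) (fun x hx => by
      have hev := eventually_all.mpr fun p => hεlim.eventually
        (eventually_add_mem hJ (hx p) (hJlt _ (hx p)))
      filter_upwards [hev] with n hn using hc n x fun p => ⟨hJ0 _ (hx p), hn p⟩)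
    fun x hx => (hright x hx).sub hφlim
  exact ⟨L, d, hd0, fun b hb => ge_of_tendsto hφlim
    (Eventually.of_forall fun n => hb _ fun _ => hεJ n), hd⟩

end AbsMono

/-- The properties of the entry domain used in the classification. -/
structure IsEntryDomain (I : Set ℝ) : Prop where
  nonempty : I.Nonempty
  ordConnected : I.OrdConnected
  abs_mem : ∀ x ∈ I, |x| ∈ I
  exists_abs_lt : ∀ x ∈ I, ∃ y ∈ I, |x| < y
  mem_of_pos : ∀ y ∈ I, ∀ x, 0 < x → x ≤ y → x ∈ I

/-- `f` sends tuples of positive semidefinite matrices with entries in `I` to matrices with at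
most `l` negative eigenvalues. -/
def PsdToNegLe {m : ℕ} (I : Set ℝ) (l : ℕ) (f : (Fin m → ℝ) → ℝ) : Prop :=
  ∀ (ι : Type) [Fintype ι] [DecidableEq ι] [Nonempty ι] (B : Fin m → Matrix ι ι ℝ),
    (∀ p, (B p).PosSemidef ∧ ∀ i j, B p i j ∈ I) →
    negEigCount (Matrix.of fun i j => f fun p => B p i j) ≤ l

theorem dotProduct_mulVec_eq_sum {ι : Type*} [Fintype ι] (A : Matrix ι ι ℝ) (v : ι → ℝ) :
    v ⬝ᵥ (A *ᵥ v) = ∑ i, ∑ j, v i * v j * A i j := by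
  simp only [dotProduct, mulVec, Finset.mul_sum]
  exact Finset.sum_congr rfl fun i _ => Finset.sum_congr rfl fun j _ => by ring

section reflectedPattern

variable {κ : Type} [Fintype κ] [DecidableEq κ] {l : ℕ}

/-- The test matrix whose entries combine `x`, `|x|` and the increments `h`. -/
noncomputable def reflectedPattern (l : ℕ) (x : ℝ) (h : κ → ℝ) :
    Matrix (Fin (l + 1) × Bool × Finset κ) (Fin (l + 1) × Bool × Finset κ) ℝ :=
  Matrix.of fun s t => (if s.2.1 = t.2.1 then |x| else x) +
    if s.1 = t.1 then ∑ i ∈ s.2.2 ∩ t.2.2, h i else 0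

theorem reflectedPattern_posSemidef (x : ℝ) {h : κ → ℝ} (hh : ∀ i, 0 ≤ h i) :
    (reflectedPattern l x h).PosSemidef := by
  let u : Fin (l + 1) × Bool × Finset κ → ℝ := fun s => if s.2.1 then 1 else if 0 ≤ x then 1 else -1
  let w : Fin (l + 1) → κ → Fin (l + 1) × Bool × Finset κ → ℝ := fun r i s =>
    if s.1 = r ∧ i ∈ s.2.2 then 1 else 0
  have heq : reflectedPattern l x h = |x| • vecMulVec u (star u) +
      ∑ r, ∑ i, h i • vecMulVec (w r i) (star (w r i)) := by
    ext ⟨r, σ, S⟩ ⟨r', σ', T⟩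
    simp only [reflectedPattern, of_apply, Matrix.add_apply, Matrix.smul_apply, vecMulVec_apply,
      Matrix.sum_apply, smul_eq_mul, star_trivial]
    congr 1
    · rcases le_or_gt 0 x with hx | hx
      · cases σ <;> cases σ' <;> simp [u, hx, abs_of_nonneg]
      · cases σ <;> cases σ' <;> simp [u, not_le.mpr hx, abs_of_neg hx]
    · by_cases hr : r = r'
      · subst hr
        rw [if_pos rfl, Finset.sum_eq_single r]
        · rw [← Finset.sum_filter_add_sum_filter_not Finset.univ (· ∈ S ∩ T)]
          rw [Finset.sum_eq_zero (s := Finset.univ.filter fun i => i ∉ S ∩ T), add_zero]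
          · refine Finset.sum_congr (by ext; simp) fun i hi => ?_
            have := (Finset.mem_filter.mp hi).2
            rw [Finset.mem_inter] at this
            simp [w, this.1, this.2]
          · intro i hi
            have := (Finset.mem_filter.mp hi).2
            rw [Finset.mem_inter, not_and_or] at this
            rcases this with h | h <;> simp [w, h]
        · intro r' _ hr'
          refine Finset.sum_eq_zero fun i _ => ?_
          simp [w, hr'.symm]
        · simp
      · rw [if_neg hr]
        refine (Finset.sum_eq_zero fun r₀ _ => Finset.sum_eq_zero fun i _ => ?_).symm
        by_cases h1 : r = r₀
        · have h2 : ¬ r' = r₀ := fun h => hr (h1.trans h.symm)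
          simp [w, h2]
        · simp [w, h1]
  rw [heq]
  refine ((posSemidef_vecMulVec_self_star u).smul (abs_nonneg x)).add ?_
  exact posSemidef_sum _ fun r _ => posSemidef_sum _ fun i _ =>
    (posSemidef_vecMulVec_self_star (w r i)).smul (hh i)

theorem reflectedPattern_mem {I : Set ℝ} (hI : IsEntryDomain I) {x : ℝ} {h : κ → ℝ}
    (hh : ∀ i, 0 ≤ h i) (hx : x ∈ I) (hy : |x| + ∑ i, h i ∈ I)
    (s t : Fin (l + 1) × Bool × Finset κ) : reflectedPattern l x h s t ∈ I := by
  have h1 : x ≤ if s.2.1 = t.2.1 then |x| else x := by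
    split_ifs
    · exact le_abs_self x
    · exact le_rfl
  have h2 : (if s.2.1 = t.2.1 then |x| else x) ≤ |x| := by
    split_ifs
    · exact le_rfl
    · exact le_abs_self x
  have h3 : 0 ≤ if s.1 = t.1 then ∑ i ∈ s.2.2 ∩ t.2.2, h i else 0 := by
    split_ifs
    · exact Finset.sum_nonneg fun i _ => hh i
    · exact le_rfl
  have h4 : (if s.1 = t.1 then ∑ i ∈ s.2.2 ∩ t.2.2, h i else 0) ≤ ∑ i, h i := by
    split_ifs
    · exact Finset.sum_le_sum_of_subset_of_nonneg (Finset.subset_univ _) fun i _ _ => hh i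
    · exact Finset.sum_nonneg fun i _ => hh i
  exact hI.ordConnected.out hx hy ⟨by rw [reflectedPattern, of_apply]; linarith,
    by rw [reflectedPattern, of_apply]; linarith⟩

end reflectedPattern

theorem PsdToNegLe.mixedDiff_add_nonneg {m : ℕ} {I : Set ℝ} {l : ℕ} {f : (Fin m → ℝ) → ℝ}
    (hI : IsEntryDomain I) (hf : PsdToNegLe I l f) {κ : Type} [Fintype κ] {x : Fin m → ℝ}
    {h : κ → Fin m → ℝ} {U : Finset κ} (hh : ∀ i p, 0 ≤ h i p) (hx : ∀ p, x p ∈ I)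
    (hy : ∀ p, |x p| + ∑ i, h i p ∈ I) (hU : U.Nonempty) {β : ℝ} (hβ : β ^ 2 = 1) :
    0 ≤ mixedDiff f (fun p => |x p|) h U + β * mixedDiff f x h U := by
  classical
  let B : Fin m → Matrix (Fin (l + 1) × Bool × Finset κ) (Fin (l + 1) × Bool × Finset κ) ℝ :=
    fun p => reflectedPattern l (x p) fun i => h i p
  have hB := hf _ B fun p => ⟨reflectedPattern_posSemidef _ fun i => hh i p,
    reflectedPattern_mem hI (fun i => hh i p) (hx p) (hy p)⟩
  set A := Matrix.of fun i j => f fun p => B p i j with hA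
  have hAH : A.IsHermitian := by
    ext s t
    simp only [hA, conjTranspose_apply, of_apply, star_trivial]
    congr 1
    funext p
    have := (reflectedPattern_posSemidef (l := l) (x p) fun i => hh i p).isHermitian.apply s t
    simpa using this
  let w : Finset κ → ℝ := fun S => if S ⊆ U then (-1) ^ S.card else 0
  let γ : Bool → ℝ := fun σ => if σ then 1 else β
  obtain ⟨a, ha, hQ⟩ := exists_nonneg_of_negEigCount_lt hAH (κ := Fin (l + 1))
    (by simpa using Nat.lt_succ_of_le hB)
    (Matrix.of fun s j => if s.1 = j then γ s.2.1 * w s.2.2 else 0)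
  have hV : (Matrix.of fun (s : Fin (l + 1) × Bool × Finset κ) j =>
      if s.1 = j then γ s.2.1 * w s.2.2 else 0) *ᵥ a = fun s => a s.1 * γ s.2.1 * w s.2.2 := by
    funext s
    simp only [mulVec, dotProduct, of_apply, ite_mul, zero_mul, Finset.sum_ite_eq,
      Finset.mem_univ, if_true]
    ring
  have hw : ∀ F : Finset κ → ℝ, ∑ S, w S * F S = ∑ S ∈ U.powerset, (-1) ^ S.card * F S := by
    intro F
    simp only [w, ite_mul, zero_mul]
    rw [← Finset.sum_filter]
    refine Finset.sum_congr ?_ fun _ _ => rfl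
    ext S
    simp
  have hD : ∀ r r' σ σ', ∑ S, ∑ T, w S * w T * A (r, σ, S) (r', σ', T) =
      if r = r' then mixedDiff f (if σ = σ' then fun p => |x p| else x) h U else 0 := by
    intro r r' σ σ'
    have h1 : ∀ S T, A (r, σ, S) (r', σ', T) =
        f ((if σ = σ' then fun p => |x p| else x) + if r = r' then ∑ i ∈ S ∩ T, h i else 0) := by
      intro S T
      simp only [hA, B, reflectedPattern, of_apply]
      congr 1
      funext p
      split_ifs <;> simp
    simp only [h1, mul_assoc, ← Finset.mul_sum]
    rw [hw]
    simp only [hw]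
    generalize (if σ = σ' then fun p => |x p| else x) = y
    by_cases hr : r = r'
    · simp only [if_pos hr, Finset.mul_sum, ← mul_assoc]
      exact sum_sum_neg_one_pow_inter (fun T => f (y + ∑ i ∈ T, h i)) U
    · simp only [if_neg hr]
      rw [← Finset.sum_mul, sum_powerset_neg_one_pow U hU, zero_mul]
  have hQ2 : (fun s : Fin (l + 1) × Bool × Finset κ => a s.1 * γ s.2.1 * w s.2.2) ⬝ᵥ
      (A *ᵥ fun s => a s.1 * γ s.2.1 * w s.2.2) =
      ∑ r, a r ^ 2 * (2 * (mixedDiff f (fun p => |x p|) h U + β * mixedDiff f x h U)) := by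
    have h2 : ∀ r r' σ σ', ∑ S, ∑ T, a r * γ σ * w S * (a r' * γ σ' * w T) *
        A (r, σ, S) (r', σ', T) = a r * a r' * (γ σ * γ σ') *
        if r = r' then mixedDiff f (if σ = σ' then fun p => |x p| else x) h U else 0 := by
      intro r r' σ σ'
      rw [← hD, Finset.mul_sum]
      refine Finset.sum_congr rfl fun S _ => ?_
      rw [Finset.mul_sum]
      exact Finset.sum_congr rfl fun T _ => by ring
    rw [dotProduct_mulVec_eq_sum, Fintype.sum_prod_type]
    refine Finset.sum_congr rfl fun r _ => ?_
    rw [Fintype.sum_prod_type]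
    have h3 : ∀ σ, ∑ S, ∑ t : Fin (l + 1) × Bool × Finset κ,
        a r * γ σ * w S * (a t.1 * γ t.2.1 * w t.2.2) * A (r, σ, S) t =
        ∑ σ', a r * a r * (γ σ * γ σ') *
          mixedDiff f (if σ = σ' then fun p => |x p| else x) h U := by
      intro σ
      have h4 : ∀ S, ∑ t : Fin (l + 1) × Bool × Finset κ,
        a r * γ σ * w S * (a t.1 * γ t.2.1 * w t.2.2) * A (r, σ, S) t = 
        ∑ r', ∑ σ', ∑ T, a r * γ σ * w S * (a r' * γ σ' * w T) * A (r, σ, S) (r', σ', T) := by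
        intro S
        rw [Fintype.sum_prod_type]
        exact Finset.sum_congr rfl fun r' _ => Fintype.sum_prod_type _
      simp only [h4]
      rw [Finset.sum_comm]
      have h5 : ∀ r', ∑ S, ∑ σ', ∑ T, a r * γ σ * w S * (a r' * γ σ' * w T) *
          A (r, σ, S) (r', σ', T) = ∑ σ', a r * a r' * (γ σ * γ σ') *
        if r = r' then mixedDiff f (if σ = σ' then fun p => |x p| else x) h U else 0 := by
        intro r'
        rw [Finset.sum_comm]
        exact Finset.sum_congr rfl fun σ' _ => h2 r r' σ σ'
      simp only [h5]
      rw [Finset.sum_eq_single r]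
      · simp
      · intro r' _ hr
        simp [hr.symm]
      · simp
    simp only [h3, Fintype.sum_bool, γ]
    simp
    linear_combination a r ^ 2 * mixedDiff f (fun p => |x p|) h U * hβ
  rw [hV, hQ2, ← Finset.sum_mul] at hQ
  have hpos : 0 < ∑ r, a r ^ 2 := by
    obtain ⟨r, hr⟩ := Function.ne_iff.mp ha
    exact Finset.sum_pos' (fun r _ => sq_nonneg _) ⟨r, Finset.mem_univ _, sq_pos_of_ne_zero hr⟩
  have := nonneg_of_mul_nonneg_right hQ hpos
  linarith

theorem PsdToNegLe.abs_mixedDiff_le {m : ℕ} {I : Set ℝ} {l : ℕ} {f : (Fin m → ℝ) → ℝ}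
    (hI : IsEntryDomain I) (hf : PsdToNegLe I l f) {κ : Type} [Fintype κ] {x : Fin m → ℝ}
    {h : κ → Fin m → ℝ} {U : Finset κ} (hh : ∀ i p, 0 ≤ h i p) (hx : ∀ p, x p ∈ I)
    (hy : ∀ p, |x p| + ∑ i, h i p ∈ I) (hU : U.Nonempty) :
    |mixedDiff f x h U| ≤ mixedDiff f (fun p => |x p|) h U := by
  have h1 := hf.mixedDiff_add_nonneg hI hh hx hy hU (β := 1) (by norm_num)
  have h2 := hf.mixedDiff_add_nonneg hI hh hx hy hU (β := -1) (by norm_num)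
  exact abs_le.mpr ⟨by linarith, by linarith⟩

theorem PsdToNegLe.absMono {m : ℕ} {I : Set ℝ} {l : ℕ} {f : (Fin m → ℝ) → ℝ}
    (hI : IsEntryDomain I) (hf : PsdToNegLe I l f) : AbsMono {x | x ∈ I ∧ 0 ≤ x} f := by
  intro κ _ x h U hx0 hh hx hy hU
  have h1 : (fun p => |x p|) = x := funext fun p => abs_of_nonneg (hx0 p)
  have := hf.abs_mixedDiff_le hI hh (fun p => (hx p).1)
    (fun p => by rw [abs_of_nonneg (hx0 p)]; exact (hy p).1) hU
  rw [h1] at this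
  exact (abs_nonneg _).trans this

theorem posSemidef_const_one {ι : Type*} [Finite ι] :
    (Matrix.of fun _ _ : ι => (1 : ℝ)).PosSemidef := by
  have := posSemidef_vecMulVec_self_star (fun _ : ι => (1 : ℝ))
  convert this using 1
  ext i j
  simp [vecMulVec_apply]

theorem posSemidef_prod_pow {m : ℕ} {ι : Type*} [Fintype ι] (B : Fin m → Matrix ι ι ℝ)
    (α : Fin m → ℕ) (h : ∀ p, α p ≠ 0 → (B p).PosSemidef) :
    (Matrix.of fun i j => ∏ p, B p i j ^ α p).PosSemidef := by
  have hpow : ∀ p, (Matrix.of fun i j => B p i j ^ α p).PosSemidef := by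
    intro p
    by_cases h0 : α p = 0
    · simpa [h0] using posSemidef_const_one (ι := ι)
    · generalize α p = n
      induction n with
      | zero => simpa using posSemidef_const_one (ι := ι)
      | succ n ih =>
        have heq : (Matrix.of fun i j => B p i j ^ (n + 1)) =
            (Matrix.of fun i j => B p i j ^ n) ⊙ B p := by
          ext i j
          simp [pow_succ]
        rw [heq]
        exact ih.hadamard (h p h0)
  have : ∀ s : Finset (Fin m), (Matrix.of fun i j => ∏ p ∈ s, B p i j ^ α p).PosSemidef := by
    intro s
    induction s using Finset.induction_on with
    | empty => simpa using posSemidef_const_one (ι := ι)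
    | insert p s hp ih =>
      have heq : (Matrix.of fun i j => ∏ q ∈ insert p s, B q i j ^ α q) =
          (Matrix.of fun i j => B p i j ^ α p) ⊙
            Matrix.of fun i j => ∏ q ∈ s, B q i j ^ α q := by
        ext i j
        simp [Finset.prod_insert hp]
      rw [heq]
      exact (hpow p).hadamard ih
  exact this Finset.univ

/-- Power series with nonnegative coefficients preserve positive semidefiniteness. -/
theorem posSemidef_of_hasSum {m : ℕ} {ι : Type*} [Fintype ι] {B : Fin m → Matrix ι ι ℝ}
    {c : (Fin m → ℕ) → ℝ} (hc : ∀ α, 0 ≤ c α) (hB : ∀ α, c α ≠ 0 → ∀ p, α p ≠ 0 → (B p).PosSemidef)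
    {F : Matrix ι ι ℝ} (hF : ∀ i j, HasSum (fun α => c α * ∏ p, B p i j ^ α p) (F i j)) :
    F.PosSemidef := by
  have hM : ∀ α, (c α • Matrix.of fun i j => ∏ p, B p i j ^ α p).PosSemidef := by
    intro α
    by_cases h0 : c α = 0
    · rw [h0, zero_smul]
      exact PosSemidef.zero
    · exact (posSemidef_prod_pow B α (hB α h0)).smul (hc α)
  rw [posSemidef_iff_dotProduct_mulVec]
  refine ⟨?_, fun v => ?_⟩
  · ext i j
    rw [conjTranspose_apply, star_trivial]
    refine (hF j i).unique ((hF i j).congr_fun fun α => ?_)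
    have := (hM α).isHermitian.apply j i
    simpa using this.symm
  · rw [star_trivial, dotProduct_mulVec_eq_sum]
    have hs : HasSum (fun α => ∑ i, ∑ j, v i * v j * (c α * ∏ p, B p i j ^ α p))
        (∑ i, ∑ j, v i * v j * F i j) :=
      hasSum_sum fun i _ => hasSum_sum fun j _ => (hF i j).mul_left _
    refine hs.nonneg fun α => ?_
    have := (posSemidef_iff_dotProduct_mulVec.mp (hM α)).2 v
    rw [star_trivial, dotProduct_mulVec_eq_sum] at this
    simpa using this

theorem psdToNegLe_of_hasSum {m : ℕ} {I : Set ℝ} {f : (Fin m → ℝ) → ℝ} {c : (Fin m → ℕ) → ℝ}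
    (hc : ∀ α, α ≠ 0 → 0 ≤ c α)
    (hf : ∀ x : Fin m → ℝ, (∀ p, x p ∈ I) → HasSum (fun α => c α * ∏ p, x p ^ α p) (f x))
    {l : ℕ} (hl : 1 ≤ l) : PsdToNegLe I l f := by
  intro ι _ _ _ B hB
  have hP : (Matrix.of fun i j => (f fun p => B p i j) - c 0).PosSemidef := by
    refine posSemidef_of_hasSum (B := B) (c := Function.update c 0 0) (fun α => ?_)
      (fun _ _ p _ => (hB p).1) fun i j => ?_
    · by_cases h : α = 0
      · simp [h]
      · simpa [h] using hc α h
    · have h1 := (hf (fun p => B p i j) fun p => (hB p).2 i j).sub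
        (hasSum_ite_eq (0 : Fin m → ℕ) (c 0))
      refine h1.congr_fun fun α => ?_
      by_cases h : α = 0
      · simp [h]
      · simp [h]
  refine (negEigCount_le_of_nonneg (k := 1) (Matrix.of fun _ _ => 1) fun v hv => ?_).trans hl
  have hv0 : ∑ i, v i = 0 := by
    have := congrFun hv 0
    simpa [mulVec, dotProduct] using this
  have h2 := (posSemidef_iff_dotProduct_mulVec.mp hP).2 v
  rw [star_trivial, dotProduct_mulVec_eq_sum] at h2
  rw [dotProduct_mulVec_eq_sum]
  simp only [of_apply, mul_sub, Finset.sum_sub_distrib] at h2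
  have h3 : ∑ i, ∑ j, v i * v j * c 0 = 0 := by
    simp only [← Finset.sum_mul, ← Finset.mul_sum]
    rw [hv0]
    ring
  rw [h3, sub_zero] at h2
  exact h2

theorem choose_mul_two_pow_le (N k : ℕ) : N.choose k * 2 ^ k ≤ (2 * N).choose k := by
  have h : N.descFactorial k * 2 ^ k ≤ (2 * N).descFactorial k := by
    induction k with
    | zero => simp
    | succ k ih =>
      rw [Nat.descFactorial_succ, Nat.descFactorial_succ]
      calc (N - k) * N.descFactorial k * 2 ^ (k + 1)
          = (2 * (N - k)) * (N.descFactorial k * 2 ^ k) := by ring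
        _ ≤ (2 * N - k) * (2 * N).descFactorial k := Nat.mul_le_mul (by omega) ih
  rw [Nat.descFactorial_eq_factorial_mul_choose, Nat.descFactorial_eq_factorial_mul_choose,
    mul_assoc] at h
  exact Nat.le_of_mul_le_mul_left h (Nat.factorial_pos k)

theorem fwdDiff_iter_neg (φ : ℝ → ℝ) (h : ℝ) (k : ℕ) (y : ℝ) :
    (fwdDiff (-h))^[k] φ y = (-1) ^ k * (fwdDiff h)^[k] φ (y - k * h) := by
  induction k generalizing y with
  | zero => simp
  | succ k ih =>
    rw [Function.iterate_succ_apply', Function.iterate_succ_apply', fwdDiff, fwdDiff, ih, ih]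
    have h1 : y + -h - k * h = y - (k + 1 : ℕ) * h := by push_cast; ring
    have h2 : y - (k + 1 : ℕ) * h + h = y - k * h := by push_cast; ring
    rw [h1, h2]
    ring

theorem fwdDiff_iter_line {V : Type*} [AddCommGroup V] [Module ℝ V] (F : V → ℝ) (x w : V) (h : ℝ)
    (k : ℕ) (t : ℝ) :
    (fwdDiff h)^[k] (fun s : ℝ => F (x + s • w)) t = (fwdDiff (h • w))^[k] F (x + t • w) := by
  induction k generalizing t with
  | zero => simp
  | succ k ih =>
    rw [Function.iterate_succ_apply', Function.iterate_succ_apply', fwdDiff, fwdDiff, ih, ih,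
      add_smul, add_assoc]

/-- A function vanishing to the right of `s + θ` whose finite differences obey a quasi-analytic
bound on `[s, s + θ]` vanishes at `s`. -/
theorem eq_zero_of_fwdDiff_bound {φ : ℝ → ℝ} {s θ Γ : ℝ} (hθ : 0 < θ)
    (h0 : ∀ t, s + θ ≤ t → t ≤ s + 2 * θ → φ t = 0)
    (hb : ∀ n : ℕ, 0 < n → ∀ k, n ≤ k → k ≤ 2 * n → ∀ t, s ≤ t → t ≤ s + θ →
      |(fwdDiff (θ / n))^[k] φ t| * (4 * n).choose k ≤ Γ) : φ s = 0 := by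
  have hΓ : 0 ≤ Γ := (mul_nonneg (abs_nonneg _) (Nat.cast_nonneg _)).trans
    (hb 1 one_pos 1 le_rfl (by norm_num) s le_rfl (by linarith))
  have key : ∀ n : ℕ, 0 < n → |φ s| ≤ Γ * ((2 * n + 1 : ℕ) * (1 / 2) ^ n) := by
    intro n hn
    have hn' : (0 : ℝ) < n := Nat.cast_pos.mpr hn
    set h := θ / n with hh
    have hh0 : 0 < h := div_pos hθ hn'
    have hnh : n * h = θ := mul_div_cancel₀ _ hn'.ne'
    have hexp := shift_eq_sum_fwdDiff_iter (-h) φ (2 * n) (s + 2 * θ)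
    have hpt : s + 2 * θ + (2 * n) • -h = s := by
      rw [nsmul_eq_mul]
      push_cast
      linear_combination -2 * hnh
    rw [hpt] at hexp
    rw [hexp]
    have hterm : ∀ k ∈ Finset.range (2 * n + 1),
        |(2 * n).choose k • (fwdDiff (-h))^[k] φ (s + 2 * θ)| ≤ Γ * (1 / 2) ^ n := by
      intro k hk
      have hk2 : k ≤ 2 * n := Nat.lt_succ_iff.mp (Finset.mem_range.mp hk)
      have hk2' : (k : ℝ) ≤ 2 * n := by exact_mod_cast hk2
      have hkh : k * h ≤ 2 * θ := by rw [← hnh]; nlinarith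
      rw [fwdDiff_iter_neg, nsmul_eq_mul, abs_mul, abs_mul, abs_pow, abs_neg, abs_one, one_pow,
        one_mul, Nat.abs_cast]
      rcases lt_or_ge k n with hkn | hkn
      · have hkn' : (k : ℝ) ≤ n := by exact_mod_cast hkn.le
        have hz : (fwdDiff h)^[k] φ (s + 2 * θ - k * h) = 0 := by
          rw [fwdDiff_iter_eq_sum_shift]
          refine Finset.sum_eq_zero fun j hj => ?_
          have hj' : (j : ℝ) ≤ k := by exact_mod_cast Nat.lt_succ_iff.mp (Finset.mem_range.mp hj)
          rw [h0, smul_zero]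
          · rw [nsmul_eq_mul]
            nlinarith [mul_nonneg j.cast_nonneg (α := ℝ) hh0.le]
          · rw [nsmul_eq_mul]
            nlinarith
        rw [hz, abs_zero, mul_zero]
        positivity
      · have hkn' : (n : ℝ) ≤ k := by exact_mod_cast hkn
        have h1 := hb n hn k hkn hk2 (s + 2 * θ - k * h) (by linarith) (by nlinarith)
        have h2 : ((2 * n).choose k : ℝ) * 2 ^ k ≤ (4 * n).choose k := by
          have := choose_mul_two_pow_le (2 * n) k
          rw [← mul_assoc] at this
          exact_mod_cast this
        set a := |(fwdDiff h)^[k] φ (s + 2 * θ - k * h)| with ha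
        have ha0 : 0 ≤ a := abs_nonneg _
        have h3 : ((2 * n).choose k * a) * 2 ^ n ≤ Γ := by
          calc ((2 * n).choose k * a) * 2 ^ n ≤ ((2 * n).choose k * a) * 2 ^ k :=
                mul_le_mul_of_nonneg_left (pow_le_pow_right₀ one_le_two hkn) (by positivity)
            _ = a * ((2 * n).choose k * 2 ^ k) := by ring
            _ ≤ a * (4 * n).choose k := mul_le_mul_of_nonneg_left h2 ha0
            _ ≤ Γ := h1
        rw [one_div, inv_pow, ← div_eq_mul_inv, le_div_iff₀ (by positivity)]
        exact h3
    refine (Finset.abs_sum_le_sum_abs _ _).trans ((Finset.sum_le_card_nsmul _ _ _ hterm).trans ?_)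
    rw [Finset.card_range, nsmul_eq_mul]
    exact le_of_eq (by ring)
  have hlim : Tendsto (fun n : ℕ => Γ * ((2 * n + 1 : ℕ) * (1 / 2 : ℝ) ^ n)) atTop (𝓝 0) := by
    have h1 := tendsto_self_mul_const_pow_of_lt_one (r := (1 / 2 : ℝ)) (by norm_num) (by norm_num)
    have h2 := tendsto_pow_atTop_nhds_zero_of_lt_one (r := (1 / 2 : ℝ)) (by norm_num) (by norm_num)
    have h3 := ((h1.const_mul 2).add h2).const_mul Γ
    rw [mul_zero, zero_add, mul_zero] at h3
    refine h3.congr fun n => ?_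
    push_cast
    ring
  have := ge_of_tendsto hlim ((eventually_gt_atTop 0).mono fun n hn => key n hn)
  exact abs_eq_zero.mp (le_antisymm this (abs_nonneg _))

namespace AbsMono

variable {m : ℕ} {J : Set ℝ} {f : (Fin m → ℝ) → ℝ}

theorem fwdDiff_iter_nonneg (hf : AbsMono J f) {x w : Fin m → ℝ} (h0 : ∀ p, 0 ≤ x p)
    (hw : ∀ p, 0 ≤ w p) (hx : ∀ p, x p ∈ J) {k : ℕ} (hk : 0 < k) (hy : ∀ p, x p + k * w p ∈ J) :
    0 ≤ (fwdDiff w)^[k] f x := by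
  have : Nonempty (Fin k) := ⟨⟨0, hk⟩⟩
  have := hf (Fin k) x (fun _ => w) Finset.univ h0 (fun _ => hw) hx (fun p => by simpa using hy p)
    Finset.univ_nonempty
  rwa [mixedDiff_same, Finset.card_univ, Fintype.card_fin] at this

theorem fwdDiff_iter_mono (hf : AbsMono J f) {x v w : Fin m → ℝ} (h0 : ∀ p, 0 ≤ x p)
    (hv : ∀ p, 0 ≤ v p) (hw : ∀ p, 0 ≤ w p) (hx : ∀ p, x p ∈ J) (k : ℕ)
    (hy : ∀ p, x p + v p + k * w p ∈ J) :
    (fwdDiff w)^[k] f x ≤ (fwdDiff w)^[k] f (x + v) := by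
  let h : Option (Fin k) → Fin m → ℝ := fun i => i.elim v fun _ => w
  have h1 := hf (Option (Fin k)) x h Finset.univ h0
    (fun i p => by cases i <;> simp [h, hv, hw]) hx (fun p => by
      rw [Fintype.sum_option]
      simpa [h, add_assoc] using hy p) Finset.univ_nonempty
  have h2 : (Finset.univ : Finset (Option (Fin k))) = insert none (Finset.univ.erase none) := by
    simp
  rw [h2, mixedDiff_insert _ _ _ (Finset.notMem_erase _ _)] at h1
  have h3 : ∀ y, mixedDiff f y h (Finset.univ.erase none) = (fwdDiff w)^[k] f y := by
    intro y
    have hcard : (Finset.univ.erase (none : Option (Fin k))).card = k := by simp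
    have h4 := mixedDiff_same f y w (Finset.univ.erase (none : Option (Fin k)))
    rw [hcard] at h4
    rw [← h4]
    refine Finset.sum_congr rfl fun T hT => ?_
    rw [Finset.sum_congr rfl (g := fun _ => w)]
    intro i hi
    have := Finset.ne_of_mem_erase (Finset.mem_powerset.mp hT hi)
    cases i
    · exact absurd rfl this
    · rfl
  rw [h3, h3] at h1
  exact sub_nonneg.mp h1

theorem choose_mul_fwdDiff_iter_le (hJ : J.OrdConnected) (hf : AbsMono J f) {x w : Fin m → ℝ}
    (h0 : ∀ p, 0 ≤ x p) (hw : ∀ p, 0 ≤ w p) (hx : ∀ p, x p ∈ J) (N : ℕ)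
    (hy : ∀ p, x p + N * w p ∈ J) {k : ℕ} (hk : 0 < k) (hkN : k ≤ N) :
    (N.choose k : ℝ) * (fwdDiff w)^[k] f x ≤ f (x + (N : ℝ) • w) - f x := by
  have h1 := shift_eq_sum_fwdDiff_iter w f N x
  have hnn : ∀ j, 0 < j → j ≤ N → 0 ≤ (fwdDiff w)^[j] f x := fun j hj hjN =>
    hf.fwdDiff_iter_nonneg h0 hw hx hj fun p => hJ.out (hx p) (hy p)
      ⟨le_add_of_nonneg_right (mul_nonneg j.cast_nonneg (hw p)),
        add_le_add_right (mul_le_mul_of_nonneg_right (by exact_mod_cast hjN) (hw p)) _⟩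
  rw [Finset.sum_range_succ'] at h1
  simp only [Function.iterate_zero, id, Nat.choose_zero_right, one_smul] at h1
  rw [Nat.cast_smul_eq_nsmul, h1, add_sub_cancel_right]
  obtain ⟨j, rfl⟩ : ∃ j, k = j + 1 := ⟨k - 1, by omega⟩
  rw [← nsmul_eq_mul]
  refine Finset.single_le_sum (f := fun j => N.choose (j + 1) • (fwdDiff w)^[j + 1] f x)
    (fun i hi => ?_) (Finset.mem_range.mpr hkN)
  rw [nsmul_eq_mul]
  exact mul_nonneg (Nat.cast_nonneg _) (hnn _ i.succ_pos (Finset.mem_range.mp hi))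

end AbsMono

namespace PsdToNegLe

variable {m : ℕ} {I : Set ℝ} {l l' : ℕ} {f g : (Fin m → ℝ) → ℝ}

theorem abs_fwdDiff_iter_le (hI : IsEntryDomain I) (hf : PsdToNegLe I l f) {x w : Fin m → ℝ}
    (hw : ∀ p, 0 ≤ w p) (hx : ∀ p, x p ∈ I) {k : ℕ} (hk : 0 < k)
    (hy : ∀ p, |x p| + k * w p ∈ I) :
    |(fwdDiff w)^[k] f x| ≤ (fwdDiff w)^[k] f fun p => |x p| := by
  have : Nonempty (Fin k) := ⟨⟨0, hk⟩⟩
  have := hf.abs_mixedDiff_le hI (κ := Fin k) (x := x) (h := fun _ => w) (U := Finset.univ)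
    (fun _ => hw) hx (fun p => by simpa using hy p) Finset.univ_nonempty
  rwa [mixedDiff_same, mixedDiff_same, Finset.card_univ, Fintype.card_fin] at this

/-- Functions with the preservation property are determined by their values at nonnegative
points. -/
theorem eq_of_eq_nonneg (hI : IsEntryDomain I) (hf : PsdToNegLe I l f) (hg : PsdToNegLe I l' g)
    (hfg : ∀ x : Fin m → ℝ, (∀ p, x p ∈ I ∧ 0 ≤ x p) → f x = g x) {x : Fin m → ℝ}
    (hx : ∀ p, x p ∈ I) : f x = g x := by
  set J : Set ℝ := {x | x ∈ I ∧ 0 ≤ x} with hJdef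
  have hJ : J.OrdConnected := ⟨fun a ha b hb t ht =>
    ⟨hI.ordConnected.out ha.1 hb.1 ht, ha.2.trans ht.1⟩⟩
  have hfa : AbsMono J f := hf.absMono hI
  have hga : AbsMono J g := hg.absMono hI
  set u : Fin m → ℝ := fun p => |x p| with hu
  set w : Fin m → ℝ := fun p => |x p| - x p with hw
  have hu0 : ∀ p, 0 ≤ u p := fun p => abs_nonneg _
  have hw0 : ∀ p, 0 ≤ w p := fun p => sub_nonneg.mpr (le_abs_self _)
  have huI : ∀ p, u p ∈ I := fun p => hI.abs_mem _ (hx p)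
  obtain ⟨θ, hθ0, hθ⟩ : ∃ θ : ℝ, 0 < θ ∧ ∀ p, u p + 5 * θ * w p ∈ I := by
    have hlt : ∀ p, ∃ y ∈ I, u p < y := fun p => hI.exists_abs_lt _ (hx p)
    obtain ⟨η, hη, hη0⟩ := ((eventually_all.mpr fun p =>
      eventually_add_mem hI.ordConnected (huI p) (hlt p)).and self_mem_nhdsWithin).exists
    have hη0 : 0 < η := hη0
    have hs : ∀ p, w p ≤ 1 + ∑ q, w q := fun p =>
      (Finset.single_le_sum (f := w) (fun q _ => hw0 q) (Finset.mem_univ p)).trans (by linarith)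
    have hW : 0 < 1 + ∑ q, w q := by
      have := Finset.sum_nonneg fun q (_ : q ∈ Finset.univ) => hw0 q
      linarith
    refine ⟨η / (5 * (1 + ∑ q, w q)), by positivity, fun p => ?_⟩
    refine hI.ordConnected.out (huI p) (hη p)
      ⟨le_add_of_nonneg_right (mul_nonneg (by positivity) (hw0 p)), add_le_add_right ?_ _⟩
    have : 5 * (η / (5 * (1 + ∑ q, w q))) * w p = η * (w p / (1 + ∑ q, w q)) := by
      field_simp
    rw [this]
    exact mul_le_of_le_one_right hη0.le ((div_le_one hW).mpr (hs p))
  have huJ : ∀ r, 0 ≤ r → r ≤ 5 * θ → ∀ p, u p + r * w p ∈ J := fun r h1 h2 p =>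
    ⟨hI.ordConnected.out (huI p) (hθ p) ⟨le_add_of_nonneg_right (mul_nonneg h1 (hw0 p)),
      add_le_add_right (mul_le_mul_of_nonneg_right h2 (hw0 p)) _⟩,
      add_nonneg (hu0 p) (mul_nonneg h1 (hw0 p))⟩
  have hxu : ∀ t p, x p + t * w p = u p + (t - 1) * w p := fun t p => by
    simp only [hu, hw]; ring
  have habs : ∀ t, 0 ≤ t → t ≤ 1 + θ → ∀ p, |x p + t * w p| ≤ u p + θ * w p := by
    intro t h1 h2 p
    rw [abs_le]
    constructor
    · have := neg_abs_le (x p)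
      have := mul_nonneg h1 (hw0 p)
      have := mul_nonneg hθ0.le (hw0 p)
      simp only [hu]
      linarith
    · rw [hxu]
      nlinarith [hw0 p]
  have hmem : ∀ t, 0 ≤ t → t ≤ 1 + θ → ∀ p, x p + t * w p ∈ I := fun t h1 h2 p =>
    hI.ordConnected.out (hx p) (huJ θ hθ0.le (by linarith) p).1
      ⟨le_add_of_nonneg_right (mul_nonneg h1 (hw0 p)), (le_abs_self _).trans (habs t h1 h2 p)⟩
  set φ : ℝ → ℝ := fun s => f (x + s • w) - g (x + s • w) with hφ
  have hφ0 : ∀ t, 1 ≤ t → t ≤ 1 + 5 * θ → φ t = 0 := by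
    intro t h1 h2
    refine sub_eq_zero.mpr (hfg _ fun p => ?_)
    have := huJ (t - 1) (by linarith) (by linarith) p
    rw [← hxu] at this
    exact this
  set Γ := 2 * (f (u + (5 * θ) • w) - f (u + θ • w)) with hΓ
  have hbound : ∀ n : ℕ, 0 < n → ∀ k, n ≤ k → k ≤ 2 * n → ∀ t, 0 ≤ t → t ≤ 1 + θ →
      |(fwdDiff (θ / n))^[k] φ t| * (4 * n).choose k ≤ Γ := by
    intro n hn k hnk hkn t ht0 ht1
    have hn' : (0 : ℝ) < n := Nat.cast_pos.mpr hn
    have hk : 0 < k := hn.trans_le hnk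
    have hkn' : (k : ℝ) ≤ 2 * n := by exact_mod_cast hkn
    set h := θ / n with hh
    have hh0 : 0 < h := div_pos hθ0 hn'
    have hnh : n * h = θ := mul_div_cancel₀ _ hn'.ne'
    have hkh : k * h ≤ 2 * θ := by rw [← hnh]; nlinarith
    have hkh0 : 0 ≤ k * h := by positivity
    have hhw : ∀ p, 0 ≤ (h • w) p := fun p => mul_nonneg hh0.le (hw0 p)
    set y : Fin m → ℝ := x + t • w with hy
    have hyI : ∀ p, y p ∈ I := hmem t ht0 ht1
    have hyabs : ∀ p, |y p| ≤ u p + θ * w p := habs t ht0 ht1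
    have hup : ∀ r, 0 ≤ r → r ≤ 2 * θ → ∀ p, |y p| + r * w p ∈ J := fun r h1 h2 p =>
      ⟨hI.ordConnected.out (hI.abs_mem _ (hyI p)) (huJ (3 * θ) (by linarith) (by linarith) p).1
        ⟨le_add_of_nonneg_right (mul_nonneg h1 (hw0 p)), by
          have := hyabs p
          have := mul_le_mul_of_nonneg_right h2 (hw0 p)
          linarith⟩, add_nonneg (abs_nonneg _) (mul_nonneg h1 (hw0 p))⟩
    have h1 := hf.abs_fwdDiff_iter_le hI (x := y) (w := h • w) hhw hyI hk fun p => by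
      have := (hup (k * h) hkh0 hkh p).1
      rwa [mul_assoc] at this
    have h2 := hg.abs_fwdDiff_iter_le hI (x := y) (w := h • w) hhw hyI hk fun p => by
      have := (hup (k * h) hkh0 hkh p).1
      rwa [mul_assoc] at this
    have h3 : (fwdDiff (h • w))^[k] g (fun p => |y p|) =
        (fwdDiff (h • w))^[k] f fun p => |y p| := by
      rw [fwdDiff_iter_eq_sum_shift, fwdDiff_iter_eq_sum_shift]
      refine Finset.sum_congr rfl fun j hj => ?_
      have hj' : (j : ℝ) ≤ k := by exact_mod_cast Nat.lt_succ_iff.mp (Finset.mem_range.mp hj)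
      rw [hfg]
      intro p
      have := hup (j * h) (by positivity) ((mul_le_mul_of_nonneg_right hj' hh0.le).trans hkh) p
      have e : ((fun p => |y p|) + j • h • w) p = |y p| + j * h * w p := by
        simp [mul_assoc]
        ring
      rw [e]
      exact this
    have h4 : (fwdDiff h)^[k] φ t = (fwdDiff (h • w))^[k] f y - (fwdDiff (h • w))^[k] g y := by
      refine (fwdDiff_iter_line (fun z => f z - g z) x w h k t).trans ?_
      rw [← hy]
      simp only [fwdDiff_iter_eq_sum_shift, smul_sub, Finset.sum_sub_distrib]
    have h5 := hfa.fwdDiff_iter_mono (x := fun p => |y p|) (v := fun p => u p + θ * w p - |y p|)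
      (w := h • w) (fun p => abs_nonneg _) (fun p => sub_nonneg.mpr (hyabs p)) hhw
      (fun p => ⟨hI.abs_mem _ (hyI p), abs_nonneg _⟩) k fun p => by
        have := huJ (θ + k * h) (by linarith) (by linarith) p
        convert this using 1
        simp only [Pi.smul_apply, smul_eq_mul]
        ring
    have h6 : (fun p => |y p|) + (fun p => u p + θ * w p - |y p|) = u + θ • w := by
      funext p
      simp
    rw [h6] at h5
    have h4n : ((4 * n : ℕ) : ℝ) * h = 4 * θ := by
      push_cast
      rw [mul_assoc, hnh]
    have h7 := hfa.choose_mul_fwdDiff_iter_le hJ (x := u + θ • w) (w := h • w)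
      (fun p => (huJ θ hθ0.le (by linarith) p).2) hhw
      (huJ θ hθ0.le (by linarith)) (4 * n) (fun p => by
        have := huJ (5 * θ) (by linarith) le_rfl p
        convert this using 1
        simp only [Pi.add_apply, Pi.smul_apply, smul_eq_mul]
        linear_combination w p * h4n) hk (by omega)
    have h8 : u + θ • w + ((4 * n : ℕ) : ℝ) • h • w = u + (5 * θ) • w := by
      rw [smul_smul, h4n, add_assoc, ← add_smul]
      congr 2
      ring
    rw [h8] at h7
    have h9 : |(fwdDiff h)^[k] φ t| ≤ 2 * (fwdDiff (h • w))^[k] f (u + θ • w) := by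
      rw [h4]
      refine (abs_sub _ _).trans ?_
      linarith
    calc _ ≤ 2 * (fwdDiff (h • w))^[k] f (u + θ • w) * ((4 * n).choose k : ℝ) :=
          mul_le_mul_of_nonneg_right h9 (Nat.cast_nonneg _)
      _ ≤ Γ := by linarith
  have hind : ∀ j : ℕ, ∀ s, 0 ≤ s → 1 - j * θ ≤ s → s ≤ 1 + 2 * θ → φ s = 0 := by
    intro j
    induction j with
    | zero =>
      intro s _ h1 h2
      exact hφ0 s (by simpa using h1) (by linarith)
    | succ j ih =>
      intro s hs0 hs1 hs2
      push_cast at hs1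
      rcases le_or_gt 1 s with h | h
      · exact hφ0 s h (by linarith)
      · exact eq_zero_of_fwdDiff_bound hθ0 (fun t h1 h2 => ih t (by linarith) (by linarith)
          (by linarith)) fun n hn k hk1 hk2 t ht1 ht2 => hbound n hn k hk1 hk2 t (by linarith)
          (by linarith)
  obtain ⟨j, hj⟩ := exists_nat_ge (1 / θ)
  rw [div_le_iff₀ hθ0] at hj
  have := hind j 0 le_rfl (by linarith) (by linarith)
  simpa [hφ, sub_eq_zero] using this

end PsdToNegLe

/-- The classification of functions sending positive semidefinite tuples to matrices with a
bounded number of negative eigenvalues. -/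
theorem PsdToNegLe.exists_hasSum {m : ℕ} {I : Set ℝ} {l : ℕ} {f : (Fin m → ℝ) → ℝ}
    (hI : IsEntryDomain I) (hf : PsdToNegLe I l f) :
    ∃ c : (Fin m → ℕ) → ℝ, (∀ α, α ≠ 0 → 0 ≤ c α) ∧
      (∀ b, (∀ x : Fin m → ℝ, (∀ p, x p ∈ I ∧ 0 ≤ x p) → b ≤ f x) → b ≤ c 0) ∧
      ∀ x : Fin m → ℝ, (∀ p, x p ∈ I) → HasSum (fun α => c α * ∏ p, x p ^ α p) (f x) := by
  obtain ⟨y₀, hy₀⟩ := hI.nonempty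
  obtain ⟨L, c, hc, hL, hs⟩ := (hf.absMono hI).exists_hasSum
    (J := {x | x ∈ I ∧ 0 ≤ x})
    ⟨fun a ha b hb t ht => ⟨hI.ordConnected.out ha.1 hb.1 ht, ha.2.trans ht.1⟩⟩
    ⟨|y₀|, hI.abs_mem _ hy₀, abs_nonneg _⟩ (fun x hx => hx.2) (fun x hx => by
      obtain ⟨y, hy, hlt⟩ := hI.exists_abs_lt _ hx.1
      rw [abs_of_nonneg hx.2] at hlt
      exact ⟨y, ⟨hy, hx.2.trans hlt.le⟩, hlt⟩)
    fun y hy x h1 h2 => ⟨hI.mem_of_pos y hy.1 x h1 h2, h1.le⟩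
  set d : (Fin m → ℕ) → ℝ := fun α => c α + if α = 0 then L else 0 with hd
  have hd0 : ∀ α, α ≠ 0 → 0 ≤ d α := fun α hα => by simpa [hd, hα] using hc α
  have hsd : ∀ x : Fin m → ℝ, (∀ p, x p ∈ I ∧ 0 ≤ x p) →
      HasSum (fun α => d α * ∏ p, x p ^ α p) (f x) := by
    intro x hx
    have h1 := (hs x hx).add (hasSum_ite_eq (0 : Fin m → ℕ) L)
    rw [sub_add_cancel] at h1
    refine h1.congr_fun fun α => ?_
    by_cases h : α = 0 <;> simp [hd, h]
  have hsum : ∀ x : Fin m → ℝ, (∀ p, x p ∈ I) → Summable fun α => d α * ∏ p, x p ^ α p := by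
    intro x hx
    have h1 := (hsd (fun p => |x p|) fun p => ⟨hI.abs_mem _ (hx p), abs_nonneg _⟩).summable.norm
    refine Summable.of_norm (h1.congr fun α => ?_)
    simp
  have hg : PsdToNegLe I 1 fun x : Fin m → ℝ => ∑' α, d α * ∏ p, x p ^ α p :=
    psdToNegLe_of_hasSum hd0 (fun x hx => (hsum x hx).hasSum) le_rfl
  refine ⟨d, hd0, fun b hb => (hL b hb).trans (by simpa [hd] using hc 0), fun x hx => ?_⟩
  have := hf.eq_of_eq_nonneg hI hg (fun y hy => (hsd y hy).tsum_eq.symm) hx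
  rw [this]
  exact (hsum x hx).hasSum

/-- Entrywise, `f` sends every tuple of sufficiently large symmetric matrices with entries in `I`
and exactly `k p` negative eigenvalues to a positive semidefinite matrix. -/
def NegEqToPsd {m : ℕ} (I : Set ℝ) (k : Fin m → ℕ) (f : (Fin m → ℝ) → ℝ) : Prop :=
  ∀ (ι : Type) [Fintype ι] [DecidableEq ι], max (Finset.univ.sup k) 1 ≤ Fintype.card ι →
    ∀ B : Fin m → Matrix ι ι ℝ,
      (∀ p, (B p).IsSymm ∧ (∀ i j, B p i j ∈ I) ∧ negEigCount (B p) = k p) →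
        (of fun i j => f fun p => B p i j).PosSemidef

theorem isSymm_iff_isHermitian {ι : Type*} {A : Matrix ι ι ℝ} : A.IsSymm ↔ A.IsHermitian := by
  rw [Matrix.IsSymm, Matrix.IsHermitian, conjTranspose_eq_transpose_of_trivial]

theorem posSemidef_bool {c d : ℝ} (h : |d| ≤ c) :
    (of fun s t : Bool => if s = t then c else d).PosSemidef := by
  refine .of_dotProduct_mulVec_nonneg (isSymm_iff_isHermitian.mp ?_) fun v => ?_
  · ext s t
    simp [eq_comm]
  · obtain ⟨h1, h2⟩ := abs_le.mp h
    simp only [star_trivial, dotProduct_mulVec_eq_sum, Fintype.sum_bool, of_apply]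
    simp
    nlinarith [mul_nonneg (by linarith : 0 ≤ c - d) (sq_nonneg (v true - v false)),
      mul_nonneg (by linarith : 0 ≤ c + d) (sq_nonneg (v true + v false))]

namespace NegEqToPsd

variable {m : ℕ} {I : Set ℝ} {k : Fin m → ℕ} {f : (Fin m → ℝ) → ℝ}

theorem le_bound (p : Fin m) : k p ≤ max (Finset.univ.sup k) 1 :=
  (Finset.le_sup (f := k) (Finset.mem_univ p)).trans (le_max_left _ _)

theorem sub_sum_indicator_eq {K : ℕ} (c d : ℝ) (o o' : Option (Fin K)) :
    c - ∑ i, d * (if o = some i ∧ o' = some i then (1 : ℝ) else 0) =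
      if o = o' ∧ o.isSome then c - d else c := by
  cases o with
  | none => simp
  | some i =>
    by_cases h : o' = some i
    · subst h
      simp [Finset.sum_ite_eq]
    · rw [if_neg (by simpa using fun e => h e.symm)]
      rw [Finset.sum_eq_zero, sub_zero]
      intro j _
      rw [if_neg, mul_zero]
      rintro ⟨h1, h2⟩
      exact h (h2.trans h1.symm)

/-- The property passes to tuples of positive semidefinite matrices that have a common index at
which the relevant diagonal entries are positive. -/
theorem posSemidef (hI : IsEntryDomain I) (hf : NegEqToPsd I k f) {α : Type} [Fintype α]
    [DecidableEq α] (A : Fin m → Matrix α α ℝ)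
    (hA : ∀ p, (A p).PosSemidef ∧ ∀ i j, A p i j ∈ I) (y : α) (hy : ∀ p, k p ≠ 0 → 0 < A p y y) :
    (of fun i j => f fun p => A p i j).PosSemidef := by
  set N := max (Finset.univ.sup k) 1 with hN
  let π : α ⊕ Fin N → α := Sum.elim id fun _ => y
  let τ : ∀ p, α ⊕ Fin N → Option (Fin (k p)) := fun p =>
    Sum.elim (fun _ => none) fun j => if h : (j : ℕ) < k p then some ⟨j, h⟩ else none
  let B : Fin m → Matrix (α ⊕ Fin N) (α ⊕ Fin N) ℝ := fun p =>
    of fun s t => A p (π s) (π t) -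
      ∑ i, (A p y y / 2) * (if τ p s = some i ∧ τ p t = some i then (1 : ℝ) else 0)
  have hB : ∀ p, (B p).IsSymm ∧ (∀ i j, B p i j ∈ I) ∧ negEigCount (B p) = k p := by
    intro p
    by_cases hp : k p = 0
    · have hBA : B p = (A p).submatrix π π := by
        ext s t
        have : IsEmpty (Fin (k p)) := hp ▸ inferInstance
        simp [B]
      rw [hBA]
      have := (hA p).1.submatrix π
      exact ⟨isSymm_iff_isHermitian.mpr this.isHermitian, fun i j => (hA p).2 _ _,
        hp ▸ (negEigCount_eq_zero_iff this.isHermitian).mpr this⟩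
    · obtain ⟨h1, h2⟩ := negEigCount_sub_indicator (hA p).1 π (τ p) (fun _ => A p y y / 2)
        (fun _ => half_pos (hy p hp)) (Sum.inl y) rfl
        (fun i => Sum.inr ⟨i, i.2.trans_le (le_bound p)⟩) (fun i => by simp [τ]) fun i => rfl
      refine ⟨isSymm_iff_isHermitian.mpr h1, fun s t => ?_, h2⟩
      simp only [B, of_apply, sub_sum_indicator_eq]
      split_ifs with h
      · have hs : ∀ s, (τ p s).isSome → π s = y := by
          rintro (s | s) hs
          · simp [τ] at hs
          · rfl
        rw [hs s h.2, hs t (h.1 ▸ h.2)]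
        have := hy p hp
        exact hI.mem_of_pos _ ((hA p).2 y y) _ (by linarith) (by linarith)
      · exact (hA p).2 _ _
  have := (hf (α ⊕ Fin N) (by
      rw [Fintype.card_sum, Fintype.card_fin]
      exact Nat.le_add_left _ _) B hB).submatrix (Sum.inl : α → α ⊕ Fin N)
  convert this using 1
  ext s t
  simp [B, π, τ]

theorem eq_of_abs_lt (hI : IsEntryDomain I) (hf : NegEqToPsd I k f) {a b : Fin m → ℝ}
    (ha : ∀ p, a p ∈ I) (hb : ∀ p, b p ∈ I) (h0 : ∀ p, k p = 0 → a p = b p)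
    (h1 : ∀ p, k p ≠ 0 → |b p| < a p) : f a = f b := by
  set a' : Fin m → ℝ := fun p => |a p| with ha'
  set b' : Fin m → ℝ := fun p => if k p = 0 then |b p| else b p with hb'
  have hapos : ∀ p, k p ≠ 0 → 0 < a p := fun p hp => (abs_nonneg _).trans_lt (h1 p hp)
  have ha'b' : ∀ p, |b' p| ≤ a' p := by
    intro p
    simp only [ha', hb']
    split_ifs with h
    · rw [abs_abs, h0 p h]
    · exact (h1 p h).le.trans (le_abs_self _)
  have ha'I : ∀ p, a' p ∈ I := fun p => hI.abs_mem _ (ha p)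
  have hb'I : ∀ p, b' p ∈ I := by
    intro p
    simp only [hb']
    split_ifs
    exacts [hI.abs_mem _ (hb p), hb p]
  have hle : f b' ≤ f a' := by
    have := hf.posSemidef hI (fun p => of fun s t : Bool => if s = t then a' p else b' p)
      (fun p => ⟨posSemidef_bool (ha'b' p), fun i j => by
        simp only [of_apply]; split_ifs; exacts [ha'I p, hb'I p]⟩) true
      fun p hp => by simpa [ha'] using (hapos p hp).ne'
    have := this.dotProduct_mulVec_nonneg fun s => if s then 1 else -1
    rw [star_trivial, dotProduct_mulVec_eq_sum] at this
    simp at this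
    linarith
  set N := max (Finset.univ.sup k) 1 with hN
  let ι : Type := (Bool × Bool) ⊕ Fin N
  let π : ι → Bool := Sum.elim Prod.snd fun _ => true
  let τ : ∀ p, k p ≠ 0 → ι → Option (Fin (k p)) := fun p hp =>
    Sum.elim (fun s => if s.1 then some ⟨0, Nat.pos_of_ne_zero hp⟩ else none)
      fun j => if h : (j : ℕ) < k p then some ⟨j, h⟩ else none
  let B : Fin m → Matrix ι ι ℝ := fun p =>
    if hp : k p = 0 then (of fun s t : Bool => if s = t then a' p else a p).submatrix π π
    else of fun s t => a p -
      ∑ i, (a p - b p) * (if τ p hp s = some i ∧ τ p hp t = some i then (1 : ℝ) else 0)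
  have hB : ∀ p, (B p).IsSymm ∧ (∀ i j, B p i j ∈ I) ∧ negEigCount (B p) = k p := by
    intro p
    by_cases hp : k p = 0
    · simp only [B, dif_pos hp]
      have := (posSemidef_bool (le_refl |a p|)).submatrix π
      refine ⟨isSymm_iff_isHermitian.mpr this.isHermitian, fun i j => ?_,
        hp ▸ (negEigCount_eq_zero_iff this.isHermitian).mpr this⟩
      simp only [submatrix_apply, of_apply]
      split_ifs
      exacts [ha'I p, ha p]
    · simp only [B, dif_neg hp]
      obtain ⟨h3, h4⟩ := negEigCount_sub_indicator
        (P := a p • (of fun _ _ : Unit => (1 : ℝ)))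
        (posSemidef_const_one.smul (hapos p hp).le) (fun _ : ι => ()) (τ p hp)
        (fun _ => a p - b p) (fun _ => sub_pos.mpr ((le_abs_self _).trans_lt (h1 p hp)))
        (Sum.inl (false, false)) rfl
        (fun i => Sum.inr ⟨i, i.2.trans_le (le_bound p)⟩) (fun i => by simp [τ]) fun i => rfl
      simp only [Matrix.smul_apply, of_apply, smul_eq_mul, mul_one] at h3 h4
      refine ⟨isSymm_iff_isHermitian.mpr h3, fun s t => ?_, h4⟩
      simp only [of_apply, sub_sum_indicator_eq]
      split_ifs
      · simpa using hb p
      · exact ha p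
  have hval : ∀ i s j t, (fun p => B p (Sum.inl (i, s)) (Sum.inl (j, t))) =
      if i = true ∧ j = true then (if s = t then b' else b) else if s = t then a' else a := by
    intro i s j t
    funext p
    by_cases hp : k p = 0
    · have := h0 p hp
      cases i <;> cases j <;> cases s <;> cases t <;> simp [B, hp, π, ha', hb', this]
    · have := abs_of_pos (hapos p hp)
      simp only [B, dif_neg hp, of_apply, sub_sum_indicator_eq]
      cases i <;> cases j <;> cases s <;> cases t <;> simp [τ, hp, ha', hb', this]
  have hpsd := (hf ι
    (by
      rw [Fintype.card_sum, Fintype.card_fin]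
      exact Nat.le_add_left _ _) B hB).submatrix (Sum.inl : Bool × Bool → ι)
  have key : ∀ w : ℝ, w ^ 2 = 1 → 0 ≤ (f b' - f a') + w * (f b - f a) := by
    intro w hw
    have := hpsd.dotProduct_mulVec_nonneg fun s =>
      (if s.1 then 1 else -1) * (if s.2 then 1 else w)
    rw [star_trivial, dotProduct_mulVec_eq_sum] at this
    simp only [submatrix_apply, of_apply, hval, Fintype.sum_prod_type, Fintype.sum_bool] at this
    simp at this
    nlinarith
  have h2 := key 1 (by norm_num)
  have h3 := key (-1) (by norm_num)
  linarith

theorem eq_of_eq (hI : IsEntryDomain I) (hf : NegEqToPsd I k f) {x y : Fin m → ℝ}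
    (hx : ∀ p, x p ∈ I) (hy : ∀ p, y p ∈ I) (h : ∀ p, k p = 0 → x p = y p) : f x = f y := by
  choose s hs hxs using fun p => hI.exists_abs_lt _ (hx p)
  choose t ht hyt using fun p => hI.exists_abs_lt _ (hy p)
  set a : Fin m → ℝ := fun p => if k p = 0 then x p else max (s p) (t p) with ha
  have haI : ∀ p, a p ∈ I := by
    intro p
    simp only [ha]
    split_ifs
    · exact hx p
    · rcases max_choice (s p) (t p) with h | h <;> rw [h]
      exacts [hs p, ht p]
  rw [← hf.eq_of_abs_lt hI haI hx (fun p hp => by simp [ha, hp])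
      fun p hp => by simpa [ha, hp] using Or.inl (hxs p),
    ← hf.eq_of_abs_lt hI haI hy (fun p hp => by simp [ha, hp, h p hp])
      fun p hp => by simpa [ha, hp] using Or.inr (hyt p)]

theorem psdToNegLe_zero (hI : IsEntryDomain I) (hf : NegEqToPsd I k f) : PsdToNegLe I 0 f := by
  intro ι _ _ _ B hB
  obtain ⟨z, hz⟩ := hI.nonempty
  obtain ⟨c, hc, hzc⟩ := hI.exists_abs_lt z hz
  have hc0 : 0 < c := (abs_nonneg z).trans_lt hzc
  let B' : Fin m → Matrix ι ι ℝ := fun p => if k p = 0 then B p else c • of fun _ _ => (1 : ℝ)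
  have hB' : ∀ p, (B' p).PosSemidef ∧ ∀ i j, B' p i j ∈ I := by
    intro p
    simp only [B']
    split_ifs
    · exact hB p
    · exact ⟨posSemidef_const_one.smul hc0.le, fun i j => by simpa using hc⟩
  have h := hf.posSemidef hI B' hB' (Classical.arbitrary ι) fun p hp => by simpa [B', hp] using hc0
  have heq : (of fun i j => f fun p => B p i j) = of fun i j => f fun p => B' p i j := by
    ext i j
    exact hf.eq_of_eq hI (fun p => (hB p).2 i j) (fun p => (hB' p).2 i j)
      fun p hp => by simp [B', hp]
  rw [heq, (negEigCount_eq_zero_iff h.isHermitian).mpr h]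

theorem exists_hasSum (hI : IsEntryDomain I) (hf : NegEqToPsd I k f) :
    ∃ c : (Fin m → ℕ) → ℝ, (∀ α, 0 ≤ c α) ∧
      (∀ α : Fin m → ℕ, (∃ p, k p ≠ 0 ∧ α p ≠ 0) → c α = 0) ∧
      ∀ x : Fin m → ℝ, (∀ p, x p ∈ I) → HasSum (fun α => c α * ∏ p, x p ^ α p) (f x) := by
  obtain ⟨c, hc, hc0, hs⟩ := (hf.psdToNegLe_zero hI).exists_hasSum hI
  have hc' : ∀ α, 0 ≤ c α := by
    intro α
    by_cases hα : α = 0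
    · subst hα
      refine hc0 0 fun x hx => ?_
      have h := hf.psdToNegLe_zero hI Unit (fun p => x p • of fun _ _ => (1 : ℝ)) fun p =>
        ⟨posSemidef_const_one.smul (hx p).2, fun i j => by simpa using (hx p).1⟩
      have := ((negEigCount_eq_zero_iff (by ext; simp)).mp (Nat.le_zero.mp h)).diag_nonneg (i := ())
      simpa using this
    · exact hc α hα
  refine ⟨c, hc', ?_, hs⟩
  rintro α ⟨p, hp, hα⟩
  obtain ⟨z, hz⟩ := hI.nonempty
  obtain ⟨b, hb, hzb⟩ := hI.exists_abs_lt z hz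
  have hb0 : 0 < b := (abs_nonneg z).trans_lt hzb
  have hb2 : b / 2 ∈ I := hI.mem_of_pos b hb _ (by linarith) (by linarith)
  set x : Fin m → ℝ := fun _ => b with hx
  set y : Fin m → ℝ := Function.update x p (b / 2) with hy
  have hyI : ∀ q, y q ∈ I := by
    intro q
    by_cases h : q = p
    · subst h; simpa [hy] using hb2
    · simpa [hy, h] using hb
  have hy0 : ∀ q, 0 < y q := by
    intro q
    by_cases h : q = p
    · subst h; simpa [hy] using hb0
    · simpa [hy, h] using hb0
  have hyx : ∀ q, y q ≤ x q := by
    intro q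
    by_cases h : q = p
    · subst h; simp [hy, hx]; linarith
    · simp [hy, h]
  have h1 := (hs x fun _ => hb).sub (hs y hyI)
  rw [hf.eq_of_eq hI (fun _ => hb) hyI fun q hq => by
    have : q ≠ p := fun e => hp (e ▸ hq)
    simp [hy, this, hx], sub_self] at h1
  rw [hasSum_zero_iff_of_nonneg fun β => by
    rw [← mul_sub]
    exact mul_nonneg (hc' β) (sub_nonneg.mpr (Finset.prod_le_prod
      (fun q _ => pow_nonneg (hy0 q).le _) fun q _ => pow_le_pow_left₀ (hy0 q).le (hyx q) _))] at h1
  have h2 := congrFun h1 α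
  simp only [Pi.zero_apply, ← mul_sub] at h2
  refine (mul_eq_zero.mp h2).resolve_right (sub_pos.mpr ?_).ne'
  refine Finset.prod_lt_prod (fun q _ => pow_pos (hy0 q) _)
    (fun q _ => pow_le_pow_left₀ (hy0 q).le (hyx q) _) ⟨p, Finset.mem_univ _, ?_⟩
  refine pow_lt_pow_left₀ ?_ (hy0 p).le hα
  simp [hy, hx]
  linarith

end NegEqToPsd

/-- The three kinds of domain considered are entry domains. -/
theorem isEntryDomain_of_eq {ρ : EReal} (hρ : 0 < ρ) {I : Set ℝ}
    (hI : I = {x : ℝ | -ρ < (x : EReal) ∧ (x : EReal) < ρ} ∨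
      I = {x : ℝ | 0 < x ∧ (x : EReal) < ρ} ∨ I = {x : ℝ | 0 ≤ x ∧ (x : EReal) < ρ}) :
    IsEntryDomain I := by
  have habs : ∀ x ∈ I, ((|x| : ℝ) : EReal) < ρ := by
    intro x hx
    rcases hI with rfl | rfl | rfl
    · rcases abs_cases x with ⟨h, _⟩ | ⟨h, _⟩ <;> rw [h]
      · exact hx.2
      · rw [EReal.coe_neg]
        exact EReal.neg_lt_comm.mp hx.1
    · rw [abs_of_pos hx.1]; exact hx.2
    · rw [abs_of_nonneg hx.1]; exact hx.2
  have hpos : ∀ x : ℝ, 0 < x → (x : EReal) < ρ → x ∈ I := by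
    intro x hx hxρ
    rcases hI with rfl | rfl | rfl
    · refine ⟨?_, hxρ⟩
      exact (EReal.neg_lt_comm.mp (by simpa using hρ) : -ρ < 0).trans (by exact_mod_cast hx)
    · exact ⟨hx, hxρ⟩
    · exact ⟨hx.le, hxρ⟩
  have hlt : ∀ x ∈ I, ∃ y ∈ I, |x| < y := by
    intro x hx
    obtain ⟨y, h1, h2⟩ := EReal.lt_iff_exists_real_btwn.mp (habs x hx)
    have h1 : |x| < y := by exact_mod_cast h1
    exact ⟨y, hpos y ((abs_nonneg x).trans_lt h1) h2, h1⟩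
  refine ⟨?_, ?_, fun x hx => ?_, hlt, fun y hy x h1 h2 => hpos x h1 ?_⟩
  · obtain ⟨y, h1, h2⟩ := EReal.lt_iff_exists_real_btwn.mp hρ
    exact ⟨y, hpos y (by exact_mod_cast h1) h2⟩
  · refine ⟨fun a ha b hb t ht => ?_⟩
    have h1 : (a : EReal) ≤ t := by exact_mod_cast ht.1
    have h2 : (t : EReal) ≤ b := by exact_mod_cast ht.2
    rcases hI with rfl | rfl | rfl
    · exact ⟨ha.1.trans_le h1, h2.trans_lt hb.2⟩
    · exact ⟨ha.1.trans_le ht.1, h2.trans_lt hb.2⟩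
    · exact ⟨ha.1.trans ht.1, h2.trans_lt hb.2⟩
  · rcases eq_or_lt_of_le (abs_nonneg x) with h | h
    · rw [← h, ← abs_eq_zero.mp h.symm]; exact hx
    · exact hpos _ h (habs x hx)
  · refine lt_of_le_of_lt ?_ (habs y hy)
    exact_mod_cast h2.trans (le_abs_self y)

theorem posSemidef_of_hasSum_of_negEigCount_le {m : ℕ} {I : Set ℝ} {k : Fin m → ℕ}
    {f : (Fin m → ℝ) → ℝ} {c : (Fin m → ℕ) → ℝ} (hc : ∀ α, 0 ≤ c α)
    (hc0 : ∀ α : Fin m → ℕ, (∃ p, k p ≠ 0 ∧ α p ≠ 0) → c α = 0)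
    (hf : ∀ x : Fin m → ℝ, (∀ p, x p ∈ I) → HasSum (fun α => c α * ∏ p, x p ^ α p) (f x))
    {ι : Type} [Fintype ι] [DecidableEq ι] {B : Fin m → Matrix ι ι ℝ}
    (hB : ∀ p, (B p).IsSymm ∧ (∀ i j, B p i j ∈ I) ∧ negEigCount (B p) ≤ k p) :
    (of fun i j => f fun p => B p i j).PosSemidef := by
  refine posSemidef_of_hasSum (B := B) hc (fun α hα p hp => ?_) fun i j =>
    hf _ fun p => (hB p).2.1 i j
  have hk : k p = 0 := by
    by_contra h
    exact hα (hc0 α ⟨p, h, hp⟩)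
  exact (negEigCount_eq_zero_iff (isSymm_iff_isHermitian.mp (hB p).1)).mp
    (Nat.le_zero.mp (hk ▸ (hB p).2.2))

theorem negEqToPsd_of_fin {m : ℕ} {I : Set ℝ} {k : Fin m → ℕ} {f : (Fin m → ℝ) → ℝ}
    (h : ∀ n : ℕ, max (Finset.univ.sup k) 1 ≤ n → ∀ B : Fin m → Matrix (Fin n) (Fin n) ℝ,
      (∀ p, (B p).IsSymm ∧ (∀ i j, B p i j ∈ I) ∧ negEigCount (B p) = k p) →
        (of fun i j => f fun p => B p i j).PosSemidef) : NegEqToPsd I k f := by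
  intro ι _ _ hι B hB
  let e := (Fintype.equivFin ι).symm
  have := (h _ hι (fun p => (B p).submatrix e e) fun p =>
    ⟨(hB p).1.submatrix e, fun i j => (hB p).2.1 _ _, by
      rw [negEigCount_submatrix_equiv (isSymm_iff_isHermitian.mp (hB p).1)]
      exact (hB p).2.2⟩).submatrix e.symm
  convert this using 1
  ext i j
  simp

theorem psdToNegLe_of_fin {m : ℕ} {I : Set ℝ} {l : ℕ} {f : (Fin m → ℝ) → ℝ}
    (h : ∀ n : ℕ, 1 ≤ n → ∀ B : Fin m → Matrix (Fin n) (Fin n) ℝ,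
      (∀ p, (B p).PosSemidef ∧ ∀ i j, B p i j ∈ I) →
        negEigCount (of fun i j => f fun p => B p i j) ≤ l) : PsdToNegLe I l f := by
  intro ι _ _ _ B hB
  let e := (Fintype.equivFin ι).symm
  have := h _ Fintype.card_pos (fun p => (B p).submatrix e e) fun p =>
    ⟨(hB p).1.submatrix e, fun i j => (hB p).2 _ _⟩
  rwa [← negEigCount_submatrix_equiv (isSymm_iff_isHermitian.mp (by
    ext i j
    simp only [transpose_apply, of_apply]
    congr 1
    funext p
    simpa using (hB p).1.isHermitian.apply i j)) e]

end

/-- Theorem 4.1 (the cases `𝐤 = 𝟎` and `l = 0`). `I` is one of `(-ρ,ρ)`, `(0,ρ)`,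
`[0,ρ)` with `0 < ρ ≤ ∞`, and `𝐤 = (k₁,…,k_m)` is admissible with `k_p = 0` for
`p ≤ m₀` and `k_p ≥ 1` for `p > m₀`; `k_max = max {1, k₁, …, k_m}`.
The conclusion conjoins: (i) each of conditions (1) and (2) is equivalent to condition (3);
and (ii) the "moreover" part for `𝐤 = 𝟎` and `l ≥ 1`. -/
theorem multivar_to_psd_iff (ρ : EReal) (hρ : 0 < ρ) (I : Set ℝ)
    (hI : I = {x : ℝ | -ρ < (x : EReal) ∧ (x : EReal) < ρ} ∨
          I = {x : ℝ | 0 < x ∧ (x : EReal) < ρ} ∨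
          I = {x : ℝ | 0 ≤ x ∧ (x : EReal) < ρ})
    (m m₀ : ℕ) (hm₀ : m₀ ≤ m) (k : Fin m → ℕ)
    (hadm : ∀ p : Fin m, ((p : ℕ) < m₀ → k p = 0) ∧ (m₀ ≤ (p : ℕ) → 1 ≤ k p))
    (f : (Fin m → ℝ) → ℝ) :
    (((∀ n : ℕ, max (Finset.univ.sup k) 1 ≤ n →
        ∀ B : Fin m → Matrix (Fin n) (Fin n) ℝ,
        (∀ p, (B p).IsSymm ∧ (∀ i j, B p i j ∈ I) ∧ negEigCount (B p) ≤ k p) →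
        (Matrix.of fun i j => f fun p => B p i j).PosSemidef) ↔
      (∃ c : (Fin m → ℕ) → ℝ, (∀ α, 0 ≤ c α) ∧
        (∀ α : Fin m → ℕ, (∃ p : Fin m, m₀ ≤ (p : ℕ) ∧ α p ≠ 0) → c α = 0) ∧
        ∀ x : Fin m → ℝ, (∀ p, x p ∈ I) →
          HasSum (fun α : Fin m → ℕ => c α * ∏ p, x p ^ α p) (f x))) ∧
     ((∀ n : ℕ, max (Finset.univ.sup k) 1 ≤ n →
        ∀ B : Fin m → Matrix (Fin n) (Fin n) ℝ,
        (∀ p, (B p).IsSymm ∧ (∀ i j, B p i j ∈ I) ∧ negEigCount (B p) = k p) →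
        (Matrix.of fun i j => f fun p => B p i j).PosSemidef) ↔
      (∃ c : (Fin m → ℕ) → ℝ, (∀ α, 0 ≤ c α) ∧
        (∀ α : Fin m → ℕ, (∃ p : Fin m, m₀ ≤ (p : ℕ) ∧ α p ≠ 0) → c α = 0) ∧
        ∀ x : Fin m → ℝ, (∀ p, x p ∈ I) →
          HasSum (fun α : Fin m → ℕ => c α * ∏ p, x p ^ α p) (f x)))) ∧
    ((∀ p, k p = 0) → ∀ l : ℕ, 1 ≤ l →
      ((∀ n : ℕ, 1 ≤ n → ∀ B : Fin m → Matrix (Fin n) (Fin n) ℝ,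
          (∀ p, (B p).PosSemidef ∧ ∀ i j, B p i j ∈ I) →
          negEigCount (Matrix.of fun i j => f fun p => B p i j) ≤ l) ↔
        (∃ c : (Fin m → ℕ) → ℝ, (∀ α : Fin m → ℕ, α ≠ 0 → 0 ≤ c α) ∧
          ∀ x : Fin m → ℝ, (∀ p, x p ∈ I) →
            HasSum (fun α : Fin m → ℕ => c α * ∏ p, x p ^ α p) (f x)))) := by
  have hD := isEntryDomain_of_eq hρ hI
  have hk : ∀ p : Fin m, k p ≠ 0 ↔ m₀ ≤ (p : ℕ) := fun p =>
    ⟨fun h => not_lt.mp fun hlt => h ((hadm p).1 hlt),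
      fun h => Nat.one_le_iff_ne_zero.mp ((hadm p).2 h)⟩
  simp only [← hk]
  refine ⟨⟨⟨fun h => ?_, ?_⟩, ⟨fun h => ?_, ?_⟩⟩, fun _ l hl => ⟨fun h => ?_, ?_⟩⟩
  · exact (negEqToPsd_of_fin fun n hn B hB =>
      h n hn B fun p => ⟨(hB p).1, (hB p).2.1, (hB p).2.2.le⟩).exists_hasSum hD
  · rintro ⟨c, hc, hc0, hs⟩ n - B hB
    exact posSemidef_of_hasSum_of_negEigCount_le hc hc0 hs hB
  · exact (negEqToPsd_of_fin h).exists_hasSum hD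
  · rintro ⟨c, hc, hc0, hs⟩ n - B hB
    exact posSemidef_of_hasSum_of_negEigCount_le hc hc0 hs fun p =>
      ⟨(hB p).1, (hB p).2.1, (hB p).2.2.le⟩
  · obtain ⟨c, hc, -, hs⟩ := (psdToNegLe_of_fin h).exists_hasSum hD
    exact ⟨c, hc, hs⟩
  · rintro ⟨c, hc, hs⟩ n hn B hB
    have : Nonempty (Fin n) := ⟨⟨0, hn⟩⟩
    exact psdToNegLe_of_hasSum hc hs hl (Fin n) B hB
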